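/- arXiv:1610.07092 — 4 statements merged into one kernel-verified Lean document; each statement's English description precedes it below -/
import Mathlib

section
/- There are absolute constants C > 0 and c > 0 such that the following holds. Let G be a finite abelian group, A ⊆ G nonempty with m_G(A+A) ≤ K·m_G(A), and let r, s ∈ ℕ with r ≥ 3. Then there exist an integer m ≥ c·s·r·(log(2K))^{1−C/r} and a symmetric set T ⊆ G with 0 ∈ T and T = −T such that mT ⊆ r(A−A) and m_G(T) ≥ exp(−C·s²·r³·log³(2K))·m_G(A). -/
open scoped BigOperators Pointwise ENNReal ENat
open Real

namespace Paper

noncomputable section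

/-- For `z` on the unit circle, `circNorm z = min {|θ| : z = exp(2πiθ)}`. -/
def circNorm (z : ℂ) : ℝ := |z.arg| / (2 * Real.pi)

variable {G : Type} [AddCommGroup G]

/-- The (generalised) Bohr set with frequency set `Γ` and width function `δ`. -/
def bohrSet (Γ : Set (AddChar G ℂ)) (δ : AddChar G ℂ → ℝ) : Set G :=
  {x | ∀ γ ∈ Γ, circNorm (γ x) < δ γ}

/-- `(Γ, δ)` generates the family of sets `F` as a Bohr system. -/
def IsBohrGen (Γ : Set (AddChar G ℂ)) (δ : AddChar G ℂ → ℝ) (F : ℝ → Set G) : Prop :=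
  (∀ γ ∈ Γ, 0 < δ γ) ∧ ∀ η : ℝ, 0 < η → η ≤ 1 → F η = bohrSet Γ (fun γ => η * δ γ)

/-- A Bohr system: a family `(B_η)_{η ∈ (0,1]}` of subsets of `G` of the form
`B_η = Bohr(Γ, ηδ)` for some generating pair `(Γ, δ)`. -/
structure BohrSystem (G : Type) [AddCommGroup G] where
  sets : ℝ → Set G
  exists_gen : ∃ Γ δ, IsBohrGen Γ δ sets

/-- The covering number `C(S;T) = min {|X| : S ⊆ X + T}`, valued in `ℕ∞`. -/
def coveringNumber {H : Type} [AddCommGroup H] (S T : Set H) : ℕ∞ :=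
  sInf {n : ℕ∞ | ∃ X : Finset H, (X.card : ℕ∞) = n ∧ S ⊆ (X : Set H) + T}

/-- Auxiliary quantity for the difference covering number, for a fixed target group `H`. -/
def dCovAux (S T : Set G) (H : Type) [AddCommGroup H] : ℕ∞ :=
  ⨅ (φ : G →+ H) (U : Set H) (V : Set H) (_ : S ⊆ φ ⁻¹' U) (_ : φ ⁻¹' (V - V) ⊆ T),
    coveringNumber U V

/-- The difference covering number `C^Δ(S;T)`: the infimum of `C_H(U;V)` over all abelian
groups `H`, homomorphisms `φ : G → H` and sets `U, V ⊆ H` with `S ⊆ φ⁻¹(U)` and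
`φ⁻¹(V − V) ⊆ T`. -/
def dCoveringNumber (S T : Set G) : ℕ∞ :=
  ⨅ (H : Type) (inst : AddCommGroup H), @dCovAux G _ S T H inst

/-- Interpret an extended natural number as a real number. -/
def enatReal (n : ℕ∞) : ℝ := (n.toNat : ℝ)

/-- The dimension of a family of sets: `sup {log₂ C^Δ(F_η; F_{η/2}) : η ∈ (0,1]}`. -/
def dimOfSets (F : ℝ → Set G) : ℝ :=
  sSup {r : ℝ | ∃ η : ℝ, 0 < η ∧ η ≤ 1 ∧
    r = Real.logb 2 (enatReal (dCoveringNumber (F η) (F (η / 2))))}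

/-- The dimension `dim B` of a Bohr system. -/
def BohrSystem.dim (B : BohrSystem G) : ℝ := dimOfSets B.sets

/-- The doubling dimension of a family of sets:
`sup {log₂ C(F_η; F_{η/2}) : η ∈ (0,1]}`. -/
def dimStarOfSets (F : ℝ → Set G) : ℝ :=
  sSup {r : ℝ | ∃ η : ℝ, 0 < η ∧ η ≤ 1 ∧
    r = Real.logb 2 (enatReal (coveringNumber (F η) (F (η / 2))))}

/-- The doubling dimension `dim* B` of a Bohr system. -/
def BohrSystem.dimStar (B : BohrSystem G) : ℝ := dimStarOfSets B.sets

/-- `B' ≤ B` for Bohr systems, i.e. `B' ∧ B = B'`, i.e. `B'_η ⊆ B_η` for all `η ∈ (0,1]`. -/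
def BohrSystem.le (B' B : BohrSystem G) : Prop :=
  ∀ η : ℝ, 0 < η → η ≤ 1 → B'.sets η ⊆ B.sets η

/-- The width of a Bohr system: `inf {‖δ‖_{ℓ∞(Γ)} : (Γ,δ) generates B}`. -/
def BohrSystem.width (B : BohrSystem G) : ℝ :=
  sInf {r : ℝ | ∃ Γ δ, IsBohrGen Γ δ B.sets ∧ r = sSup (δ '' Γ)}

/-- The `n`-fold sumset `nS = S + ⋯ + S`. -/
def iterSum : ℕ → Set G → Set G
  | 0, _ => {0}
  | n + 1, S => S + iterSum n S

/-- The set of all cosets of subgroups of `G`. -/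
def cosets (G : Type) [AddCommGroup G] : Set (Set G) :=
  {W | ∃ (H : AddSubgroup G) (x : G), W = (fun h => x + h) '' (H : Set G)}

/-- The set of cosets of a fixed subgroup `H` of `G`. -/
def cosetsOf (H : AddSubgroup G) : Set (Set G) :=
  {W | ∃ x : G, W = (fun h => x + h) '' (H : Set G)}

/-- `f` is `ε`-almost integer-valued, with integer part `fZ`. -/
def AlmostInt (ε : ℝ) (f : G → ℂ) (fZ : G → ℤ) : Prop :=
  ∀ x, ‖f x - (fZ x : ℂ)‖ ≤ ε

/-- The `ρ`-approximate annihilator `N(S,ρ)` of a set `S ⊆ G`. -/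
def annihilator (S : Set G) (ρ : ℝ) : Set (AddChar G ℂ) :=
  {γ | ∀ x ∈ S, ‖(1 : ℂ) - γ x‖ < ρ}

/-- `A` is `(m,l)`-arithmetically connected. -/
def ArithConnected (m l : ℕ) (A : Set G) : Prop :=
  ∀ x : Fin m → G, (∀ i, x i ∈ A) →
    ∃ σ : Fin m → ℤ, (∑ i, (σ i).natAbs) ≤ l ∧
      (∃ i j, i ≠ j ∧ (σ i).natAbs = 1 ∧ (σ j).natAbs = 1) ∧
      (∑ i, σ i • x i) ∈ A

variable [Fintype G]

/-- The Haar probability measure of a subset of the finite group `G`. -/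
def haar (S : Set G) : ℝ := (Nat.card S : ℝ) / (Fintype.card G : ℝ)

/-- A probability measure on the finite group `G`, given by its weight function. -/
def IsProb (w : G → ℝ) : Prop := (∀ x, 0 ≤ w x) ∧ ∑ x, w x = 1

/-- The measure of `S` under the weight function `w`. -/
def wMeasure (w : G → ℝ) (S : Set G) : ℝ := ∑ x, S.indicator w x

/-- The probability measure `μ_S`: `μ` restricted to `S` and normalised. -/
def restrictProb (w : G → ℝ) (S : Set G) : G → ℝ :=
  fun x => S.indicator w x / wMeasure w S

/-- The probability measure `w` is `F`-approximately invariant: for every `η ∈ (0,1]` there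
are probability measures `w⁺, w⁻` with `(1−η)·w⁻ ≤ τ_x(w) ≤ (1+η)·w⁺` for all `x ∈ F η`. -/
def ApproxInvariant (F : ℝ → Set G) (w : G → ℝ) : Prop :=
  ∀ η : ℝ, 0 < η → η ≤ 1 → ∃ wp wm : G → ℝ, IsProb wp ∧ IsProb wm ∧
    ∀ x ∈ F η, ∀ y : G, (1 - η) * wm y ≤ w (y - x) ∧ w (y - x) ≤ (1 + η) * wp y

/-- The Fourier coefficient `f̂(γ) = (1/|G|) ∑_x f(x) conj(γ(x))`. -/
def fourierCoeff (f : G → ℂ) (γ : AddChar G ℂ) : ℂ :=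
  (Fintype.card G : ℂ)⁻¹ * ∑ x, f x * (starRingEnd ℂ) (γ x)

/-- The Wiener norm `‖f‖_{A(G)} = ∑_γ |f̂(γ)|`. -/
def wienerNorm (f : G → ℂ) : ℝ := ∑ᶠ γ : AddChar G ℂ, ‖fourierCoeff f γ‖

/-- The Fourier transform `μ̂(γ) = ∫ conj(γ(x)) dμ(x)` of a measure with weight `w`. -/
def fourierWeight (w : G → ℝ) (γ : AddChar G ℂ) : ℂ :=
  ∑ x, (starRingEnd ℂ) (γ x) * (w x : ℂ)

/-- Convolution `f ∗ μ (x) = ∫ f(x−y) dμ(y)` of a complex function with a measure. -/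
def convC (f : G → ℂ) (w : G → ℝ) (x : G) : ℂ := ∑ y, f (x - y) * (w y : ℂ)

/-- Convolution `f ∗ μ (x) = ∫ f(x−y) dμ(y)` of a real function with a measure. -/
def convR (f : G → ℝ) (w : G → ℝ) (x : G) : ℝ := ∑ y, f (x - y) * w y

/-- Convolution of functions w.r.t. Haar measure: `f ∗ g (x) = (1/|G|) ∑_y f(y) g(x−y)`. -/
def convFun (f g : G → ℝ) (x : G) : ℝ := (Fintype.card G : ℝ)⁻¹ * ∑ y, f y * g (x - y)

/-- The `L_p` norm `(∫ |f|^p dν)^{1/p}` w.r.t. the measure with weight `w`. -/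
def LpW (p : ℝ) (w : G → ℝ) (f : G → ℂ) : ℝ := (∑ y, w y * ‖f y‖ ^ p) ^ (1 / p)

/-- `X` has relative polynomial growth of order `d`. -/
def HasRPG (X : Set G) (d : ℝ) : Prop :=
  ∀ n : ℕ, 1 ≤ n → haar (iterSum n X) ≤ (n : ℝ) ^ d * haar X

end

section Helpers

open Finset

lemma mgf_one {G : Type} (S : Finset G) (hS : S.Nonempty) (φ : G → ℝ)
    (h0 : ∀ x, 0 ≤ φ x) (h1 : ∀ x, φ x ≤ 1) (u : ℝ) (hu : |u| ≤ 1) :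
    ∑ s ∈ S, Real.exp (u * (φ s - (∑ s ∈ S, φ s) / #S)) ≤ #S * Real.exp (u ^ 2) := by
  set h := (∑ s ∈ S, φ s) / #S with hh
  have hc : (0 : ℝ) < #S := by exact_mod_cast hS.card_pos
  have hsum : ∑ s ∈ S, φ s = #S * h := by rw [hh]; field_simp
  have hh0 : 0 ≤ h := div_nonneg (Finset.sum_nonneg fun i _ => h0 i) hc.le
  have hh1 : h ≤ 1 := by
    rw [hh, div_le_one hc]
    calc ∑ s ∈ S, φ s ≤ ∑ s ∈ S, (1 : ℝ) := Finset.sum_le_sum fun i _ => h1 i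
      _ = #S := by simp
  have key : ∀ s ∈ S, Real.exp (u * (φ s - h)) ≤ 1 + u * (φ s - h) + u ^ 2 := by
    intro s _
    have hd : |φ s - h| ≤ 1 := by
      rw [abs_le]; constructor <;> linarith [h0 s, h1 s]
    have hx : |u * (φ s - h)| ≤ 1 := by
      rw [abs_mul]; exact mul_le_one₀ hu (abs_nonneg _) hd
    have := (abs_le.mp (Real.abs_exp_sub_one_sub_id_le hx)).2
    have h2 : (u * (φ s - h)) ^ 2 ≤ u ^ 2 := by
      rw [mul_pow]
      have : (φ s - h) ^ 2 ≤ 1 := by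
        rw [← sq_abs]; exact pow_le_one₀ (abs_nonneg _) hd
      nlinarith [sq_nonneg u]
    linarith
  calc _ ≤ ∑ s ∈ S, (1 + u * (φ s - h) + u ^ 2) := Finset.sum_le_sum key
    _ = #S * (1 + u ^ 2) := by
      rw [Finset.sum_add_distrib, Finset.sum_add_distrib, ← Finset.mul_sum,
        Finset.sum_sub_distrib, hsum]
      simp only [Finset.sum_const, nsmul_eq_mul]; ring
    _ ≤ _ := mul_le_mul_of_nonneg_left (by linarith [Real.add_one_le_exp (u ^ 2)]) hc.le

lemma mgf_many {G : Type} (S : Finset G) (hS : S.Nonempty) (φ : G → ℝ)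
    (h0 : ∀ x, 0 ≤ φ x) (h1 : ∀ x, φ x ≤ 1) (k : ℕ) (hk : 0 < k) (θ : ℝ) (hu : |θ| ≤ k) :
    ∑ z ∈ Fintype.piFinset (fun _ : Fin k => S),
      Real.exp (θ * ((∑ i, φ (z i)) / k - (∑ s ∈ S, φ s) / #S))
      ≤ (#S : ℝ) ^ k * Real.exp (θ ^ 2 / k) := by
  have hk' : (0 : ℝ) < k := by exact_mod_cast hk
  set h := (∑ s ∈ S, φ s) / #S with hh
  have e1 : ∀ z : Fin k → G, Real.exp (θ * ((∑ i, φ (z i)) / k - h))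
      = ∏ i, Real.exp (θ / k * (φ (z i) - h)) := by
    intro z
    rw [← Real.exp_sum, ← Finset.mul_sum, Finset.sum_sub_distrib]
    congr 1
    simp only [Finset.sum_const, nsmul_eq_mul, Finset.card_univ, Fintype.card_fin]
    field_simp
  simp_rw [e1]
  rw [← Finset.sum_pow' S (fun s => Real.exp (θ / k * (φ s - h))) k]
  have hu' : |θ / k| ≤ 1 := by
    rw [abs_div, abs_of_pos hk', div_le_one hk']; exact hu
  calc _ ≤ ((#S : ℝ) * Real.exp ((θ / k) ^ 2)) ^ k := by
        gcongr
        exact mgf_one S hS φ h0 h1 _ hu'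
    _ = _ := by
        rw [mul_pow, ← Real.exp_nat_mul]
        congr 2
        field_simp

/-- the smoothed function -/
noncomputable def hAvg {G : Type} [AddCommGroup G] [DecidableEq G] (D S : Finset G) (y : G) : ℝ :=
  (∑ s ∈ S, if y + s ∈ D then (1 : ℝ) else 0) / #S

/-- the sampled function -/
noncomputable def hSmp {G : Type} [AddCommGroup G] [DecidableEq G] (D : Finset G) (k : ℕ)
    (z : Fin k → G) (y : G) : ℝ :=
  (∑ i, if y + z i ∈ D then (1 : ℝ) else 0) / k

lemma good_sample {G : Type} [AddCommGroup G] [DecidableEq G] (B S : Finset G)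
    (hB : B.Nonempty) (hS : S.Nonempty) (m k : ℕ) (hm : 0 < m) (b : ℝ) (hb : 0 ≤ b)
    (hU : (#(B + S - S) : ℝ) ≤ Real.exp b * #B) (hk : 64 * (m : ℝ) ^ 2 * (b + 2) ≤ k) :
    ∃ Λ ⊆ Fintype.piFinset (fun _ : Fin k => S), (#S : ℝ) ^ k ≤ 2 * #Λ ∧
      ∀ z ∈ Λ, ∀ v : G, ∑ x ∈ B, |hSmp (B + S) k z (x + v) - hAvg (B + S) S (x + v)|
        ≤ #B / (4 * m) := by
  classical
  set D := B + S with hD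
  set U := B + S - S with hUd
  have hm' : (1 : ℝ) ≤ m := by exact_mod_cast hm
  have hBc : (0 : ℝ) < #B := by exact_mod_cast hB.card_pos
  have hSc : (0 : ℝ) < #S := by exact_mod_cast hS.card_pos
  have hUc : (0 : ℝ) < #U := by
    exact_mod_cast ((hB.add hS).sub hS).card_pos
  have hkpos : (0 : ℝ) < k := by
    have : 0 < 64 * (m : ℝ) ^ 2 * (b + 2) := by positivity
    linarith
  have hk0 : 0 < k := by exact_mod_cast hkpos
  set θ : ℝ := 8 * m * (b + 2) with hθ
  have hθ0 : 0 < θ := by positivity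
  have hθk : 8 * m * θ ≤ k := by rw [hθ]; linarith
  have hθk1 : θ ≤ k := by nlinarith
  have hθq : θ ^ 2 / k ≤ b + 2 := by
    rw [div_le_iff₀ hkpos]
    have : θ ^ 2 = (8 * m * θ) * (b + 2) := by rw [hθ]; ring
    rw [this, mul_comm]
    gcongr
  set g : (Fin k → G) → G → ℝ := fun z y => hSmp D k z y - hAvg D S y with hg
  set P := Fintype.piFinset (fun _ : Fin k => S) with hP
  have hPc : (#P : ℝ) = (#S : ℝ) ^ k := by
    rw [hP, Fintype.card_piFinset_const]; push_cast; rfl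
  set Φ : (Fin k → G) → ℝ := fun z => ∑ y ∈ U, (Real.exp (θ * g z y) + Real.exp (-θ * g z y))
    with hΦ
  have hΦ0 : ∀ z, 0 ≤ Φ z := fun z => Finset.sum_nonneg fun _ _ => by positivity
  set E := Real.exp (θ ^ 2 / k) with hE
  have hE0 : 0 < E := Real.exp_pos _
  have hsum : ∑ z ∈ P, Φ z ≤ 2 * #U * E * (#S : ℝ) ^ k := by
    rw [hΦ, Finset.sum_comm]
    have : ∀ y ∈ U, ∑ z ∈ P, (Real.exp (θ * g z y) + Real.exp (-θ * g z y))
        ≤ 2 * E * (#S : ℝ) ^ k := by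
      intro y _
      rw [Finset.sum_add_distrib]
      have a1 := mgf_many S hS (fun s => if y + s ∈ D then (1 : ℝ) else 0)
        (fun x => by split_ifs <;> norm_num) (fun x => by split_ifs <;> norm_num) k hk0 θ
        (by rw [abs_of_pos hθ0]; exact hθk1)
      have a2 := mgf_many S hS (fun s => if y + s ∈ D then (1 : ℝ) else 0)
        (fun x => by split_ifs <;> norm_num) (fun x => by split_ifs <;> norm_num) k hk0 (-θ)
        (by rw [abs_neg, abs_of_pos hθ0]; exact hθk1)
      rw [neg_sq] at a2
      have : 2 * E * (#S : ℝ) ^ k = (#S : ℝ) ^ k * E + (#S : ℝ) ^ k * E := by ring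
      rw [this]
      exact add_le_add a1 a2
    calc _ ≤ ∑ y ∈ U, 2 * E * (#S : ℝ) ^ k := Finset.sum_le_sum this
      _ = _ := by rw [Finset.sum_const, nsmul_eq_mul]; ring
  refine ⟨P.filter (fun z => Φ z ≤ 4 * #U * E), Finset.filter_subset _ _, ?_, ?_⟩
  · have hsplit := Finset.card_filter_add_card_filter_not (s := P) (fun z => Φ z ≤ 4 * #U * E)
    have hbad : (#(P.filter (fun z => ¬ Φ z ≤ 4 * #U * E)) : ℝ) * (4 * #U * E)
        ≤ 2 * #U * E * (#S : ℝ) ^ k := by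
      calc _ = ∑ z ∈ P.filter (fun z => ¬ Φ z ≤ 4 * #U * E), (4 * #U * E) := by
            rw [Finset.sum_const, nsmul_eq_mul]
        _ ≤ ∑ z ∈ P.filter (fun z => ¬ Φ z ≤ 4 * #U * E), Φ z := by
            apply Finset.sum_le_sum
            intro z hz
            exact (not_le.mp (Finset.mem_filter.mp hz).2).le
        _ ≤ ∑ z ∈ P, Φ z :=
            Finset.sum_le_sum_of_subset_of_nonneg (Finset.filter_subset _ _) fun _ _ _ => hΦ0 _
        _ ≤ _ := hsum
    have hbad2 : 2 * (#(P.filter (fun z => ¬ Φ z ≤ 4 * #U * E)) : ℝ) ≤ (#S : ℝ) ^ k := by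
      have hp : (0 : ℝ) < 2 * #U * E := by positivity
      refine le_of_mul_le_mul_left ?_ hp
      linarith
    have hs2 : (#(P.filter (fun z => Φ z ≤ 4 * #U * E)) : ℝ)
        + #(P.filter (fun z => ¬ Φ z ≤ 4 * #U * E)) = (#S : ℝ) ^ k := by
      rw [← hPc]; exact_mod_cast hsplit
    linarith
  · intro z hz v
    obtain ⟨hzP, hzΦ⟩ := Finset.mem_filter.mp hz
    rw [hP, Fintype.mem_piFinset] at hzP
    have hout : ∀ y, y ∉ U → g z y = 0 := by
      intro y hy
      have hn : ∀ s ∈ S, y + s ∉ D := by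
        intro s hs hys
        exact hy (by
          have := Finset.sub_mem_sub hys hs
          simpa using this)
      have q1 : hSmp D k z y = 0 := by
        unfold hSmp
        rw [Finset.sum_eq_zero, zero_div]
        intro i _
        rw [if_neg (hn _ (hzP i))]
      have q2 : hAvg D S y = 0 := by
        unfold hAvg
        rw [Finset.sum_eq_zero, zero_div]
        intro i hi
        rw [if_neg (hn _ hi)]
      simp [hg, q1, q2]
    set c : ℝ := b + θ ^ 2 / k + 2 with hc
    have hpt : ∀ y, θ * |g z y| ≤ c - 1 + Real.exp (-c) * Real.exp (θ * |g z y|) := by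
      intro y
      rw [← Real.exp_add]
      linarith [Real.add_one_le_exp (-c + θ * |g z y|)]
    have hexp : ∑ x ∈ B, Real.exp (θ * |g z (x + v)|) ≤ #B + 4 * #U * E := by
      have hle : ∀ x ∈ B, Real.exp (θ * |g z (x + v)|) ≤ 1 +
          (if x + v ∈ U then Real.exp (θ * g z (x + v)) + Real.exp (-θ * g z (x + v)) else 0) := by
        intro x _
        split_ifs with hxU
        · rcases abs_cases (g z (x + v)) with ⟨h, _⟩ | ⟨h, _⟩ <;> rw [h]
          · linarith [Real.exp_pos (-θ * g z (x + v))]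
          · rw [show θ * -g z (x + v) = -θ * g z (x + v) by ring]
            linarith [Real.exp_pos (θ * g z (x + v))]
        · rw [hout _ hxU]; simp
      calc _ ≤ _ := Finset.sum_le_sum hle
        _ = #B + ∑ x ∈ B, (if x + v ∈ U then
              Real.exp (θ * g z (x + v)) + Real.exp (-θ * g z (x + v)) else 0) := by
            rw [Finset.sum_add_distrib]; simp
        _ ≤ #B + Φ z := by
            gcongr
            rw [← Finset.sum_filter]
            rw [← Finset.sum_image (s := B.filter (fun x => x + v ∈ U)) (g := fun x => x + v)
              (f := fun y => Real.exp (θ * g z y) + Real.exp (-θ * g z y))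
              (fun x _ y _ h => by simpa using h)]
            apply Finset.sum_le_sum_of_subset_of_nonneg
            · intro y hy
              obtain ⟨x, hx, rfl⟩ := Finset.mem_image.mp hy
              exact (Finset.mem_filter.mp hx).2
            · intros; positivity
        _ ≤ _ := by gcongr
    have hsumθ : θ * ∑ x ∈ B, |g z (x + v)| ≤ c * #B := by
      calc θ * ∑ x ∈ B, |g z (x + v)| = ∑ x ∈ B, θ * |g z (x + v)| := by rw [Finset.mul_sum]
        _ ≤ ∑ x ∈ B, (c - 1 + Real.exp (-c) * Real.exp (θ * |g z (x + v)|)) :=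
            Finset.sum_le_sum fun x _ => hpt _
        _ = (c - 1) * #B + Real.exp (-c) * ∑ x ∈ B, Real.exp (θ * |g z (x + v)|) := by
            rw [Finset.sum_add_distrib, Finset.mul_sum, Finset.sum_const, nsmul_eq_mul]; ring
        _ ≤ (c - 1) * #B + Real.exp (-c) * (#B + 4 * #U * E) := by gcongr
        _ ≤ (c - 1) * #B + Real.exp (-c) * (5 * Real.exp (b + θ ^ 2 / k) * #B) := by
            gcongr
            have e1 : (1 : ℝ) ≤ Real.exp (b + θ ^ 2 / k) := Real.one_le_exp (by positivity)
            have e2 : (#U : ℝ) * E ≤ Real.exp (b + θ ^ 2 / k) * #B := by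
              rw [Real.exp_add, hE]
              nlinarith [Real.exp_pos (θ ^ 2 / k)]
            nlinarith
        _ = (c - 1) * #B + (5 * Real.exp (-2)) * #B := by
            have : Real.exp (-c) * Real.exp (b + θ ^ 2 / k) = Real.exp (-2) := by
              rw [← Real.exp_add]; congr 1; rw [hc]; ring
            rw [← this]; ring
        _ ≤ c * #B := by
            have : 5 * Real.exp (-2) ≤ 1 := by
              rw [Real.exp_neg]
              have h1 := Real.exp_one_gt_d9
              have h2 : Real.exp 2 = Real.exp 1 * Real.exp 1 := by
                rw [← Real.exp_add]; norm_num
              have h3 : 5 ≤ Real.exp 2 := by rw [h2]; nlinarith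
              rw [← div_eq_mul_inv, div_le_one (Real.exp_pos _)]; exact h3
            nlinarith
    have hcle : c ≤ 2 * (b + 2) := by rw [hc]; linarith
    have hfin : θ * ∑ x ∈ B, |g z (x + v)| ≤ 2 * (b + 2) * #B := by
      refine hsumθ.trans ?_
      gcongr
    rw [le_div_iff₀ (by positivity)]
    rw [hθ] at hfin
    have hb2 : 0 < b + 2 := by linarith
    have : (b + 2) * (2 * ((∑ x ∈ B, |g z (x + v)|) * (4 * m))) ≤ (b + 2) * (2 * #B) := by
      nlinarith
    have := le_of_mul_le_mul_left this hb2
    linarith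

lemma croot_sisask {G : Type} [AddCommGroup G] [DecidableEq G] (B S X : Finset G)
    (hB : B.Nonempty) (hS : S.Nonempty) (hX : X.Nonempty) (m k : ℕ) (hm : 0 < m)
    (a b : ℝ) (hb : 0 ≤ b)
    (hU : (#(B + S - S) : ℝ) ≤ Real.exp b * #B) (hSX : (#(S + X) : ℝ) ≤ Real.exp a * #S)
    (hk : 64 * (m : ℝ) ^ 2 * (b + 2) ≤ k) :
    ∃ T : Finset G, (0 : G) ∈ T ∧ -T = T ∧ m • T ⊆ B + S - S - B ∧
      Real.exp (-(k * a + 1)) * #X ≤ #T := by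
  classical
  obtain ⟨Λ, hΛS, hΛc, hΛ⟩ := good_sample B S hB hS m k hm b hb hU hk
  have hm' : (1 : ℝ) ≤ m := by exact_mod_cast hm
  have hBc : (0 : ℝ) < #B := by exact_mod_cast hB.card_pos
  have hSc : (0 : ℝ) < #S := by exact_mod_cast hS.card_pos
  have hXc : (0 : ℝ) < #X := by exact_mod_cast hX.card_pos
  set Q := Fintype.piFinset (fun _ : Fin k => S + X) with hQ
  have hQne : Q.Nonempty := by
    rw [hQ, Fintype.piFinset_nonempty]; exact fun _ => hS.add hX
  have hQc : (#Q : ℝ) = (#(S + X) : ℝ) ^ k := by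
    rw [hQ, Fintype.card_piFinset_const]; push_cast; rfl
  set Y : (Fin k → G) → Finset G := fun w => X.filter (fun x => (fun i => w i - x) ∈ Λ) with hY
  have hcount : ∑ w ∈ Q, (#(Y w) : ℝ) = #X * #Λ := by
    have : ∑ w ∈ Q, #(Y w) = ∑ x ∈ X, #Λ := by
      simp_rw [hY, Finset.card_filter]
      rw [Finset.sum_comm]
      apply Finset.sum_congr rfl
      intro x hx
      rw [← Finset.card_filter]
      apply Finset.card_bij (fun w _ => fun i => w i - x)
      · intro w hw; exact (Finset.mem_filter.mp hw).2
      · intro w _ w' _ h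
        funext i
        have := congrFun h i
        simpa using this
      · intro z hz
        refine ⟨fun i => z i + x, ?_, by simp⟩
        rw [Finset.mem_filter]
        refine ⟨?_, by simpa using hz⟩
        rw [hQ, Fintype.mem_piFinset]
        intro i
        exact Finset.add_mem_add (Fintype.mem_piFinset.mp (hΛS hz) i) hx
    rw [Finset.sum_const, smul_eq_mul] at this
    exact_mod_cast this
  have hex : ∃ w ∈ Q, Real.exp (-(k * a + 1)) * #X ≤ #(Y w) := by
    apply Finset.exists_le_of_sum_le hQne
    rw [hcount, Finset.sum_const, nsmul_eq_mul, hQc]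
    have h1 : (#(S + X) : ℝ) ^ k ≤ Real.exp (k * a) * (#S : ℝ) ^ k := by
      rw [Real.exp_nat_mul, ← mul_pow]
      gcongr
    have h2 : Real.exp (-(k * a + 1)) * Real.exp (k * a) = Real.exp (-1) := by
      rw [← Real.exp_add]; congr 1; ring
    have h3 : 2 * Real.exp (-1) ≤ 1 := by
      rw [Real.exp_neg, ← div_eq_mul_inv, div_le_one (Real.exp_pos _)]
      linarith [Real.exp_one_gt_d9]
    calc (#(S + X) : ℝ) ^ k * (Real.exp (-(k * a + 1)) * #X)
        ≤ (Real.exp (k * a) * (#S : ℝ) ^ k) * (Real.exp (-(k * a + 1)) * #X) := by gcongr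
      _ = Real.exp (-1) * (#S : ℝ) ^ k * #X := by rw [← h2]; ring
      _ ≤ Real.exp (-1) * (2 * #Λ) * #X := by gcongr
      _ = (2 * Real.exp (-1)) * (#X * #Λ) := by ring
      _ ≤ 1 * (#X * #Λ) := by gcongr
      _ = _ := one_mul _
  obtain ⟨w, _, hw⟩ := hex
  have hYne : (Y w).Nonempty := by
    rw [← Finset.card_pos]
    have : (0 : ℝ) < #(Y w) := lt_of_lt_of_le (by positivity) hw
    exact_mod_cast this
  have hstep : ∀ t ∈ Y w - Y w, ∀ v : G,
      ∑ x ∈ B, |hAvg (B + S) S (x + v) - hAvg (B + S) S (x + (t + v))| ≤ #B / (2 * m) := by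
    intro t ht v
    obtain ⟨x₁, hx₁, x₂, hx₂, rfl⟩ := Finset.mem_sub.mp ht
    have g1 := hΛ _ (Finset.mem_filter.mp hx₁).2 (x₁ - x₂ + v)
    have g2 := hΛ _ (Finset.mem_filter.mp hx₂).2 v
    have heq : ∀ x, hSmp (B + S) k (fun i => w i - x₁) (x + (x₁ - x₂ + v))
        = hSmp (B + S) k (fun i => w i - x₂) (x + v) := by
      intro x
      unfold hSmp
      have : ∀ i, x + (x₁ - x₂ + v) + (w i - x₁) = x + v + (w i - x₂) := fun i => by abel
      simp_rw [this]
    have hsp : (#B : ℝ) / (2 * m) = #B / (4 * m) + #B / (4 * m) := by field_simp; ring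
    rw [hsp]
    refine le_trans ?_ (add_le_add g1 g2)
    rw [← Finset.sum_add_distrib]
    apply Finset.sum_le_sum
    intro x _
    rw [heq]
    have e := abs_sub_le (hAvg (B + S) S (x + v)) (hSmp (B + S) k (fun i => w i - x₂) (x + v))
      (hAvg (B + S) S (x + (x₁ - x₂ + v)))
    have c1 := abs_sub_comm (hAvg (B + S) S (x + v)) (hSmp (B + S) k (fun i => w i - x₂) (x + v))
    linarith
  have hone : ∀ x ∈ B, hAvg (B + S) S x = 1 := by
    intro x hx
    unfold hAvg
    rw [Finset.sum_congr rfl (fun s hs => if_pos (Finset.add_mem_add hx hs))]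
    simp only [Finset.sum_const, nsmul_eq_mul]
    field_simp
  have hpath : ∀ j : ℕ, ∀ t ∈ j • (Y w - Y w),
      ∑ x ∈ B, (1 - hAvg (B + S) S (x + t)) ≤ j * (#B / (2 * m)) := by
    intro j
    induction j with
    | zero =>
      intro t ht
      rw [zero_nsmul, Finset.mem_zero] at ht
      subst ht
      rw [Finset.sum_eq_zero]
      · simp
      · intro x hx
        rw [add_zero, hone x hx, sub_self]
    | succ j ih =>
      intro t ht
      rw [succ_nsmul, Finset.mem_add] at ht
      obtain ⟨v, hv, u, hu, rfl⟩ := ht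
      have h1 := ih v hv
      have h2 := hstep u hu v
      have h3 : ∑ x ∈ B, (1 - hAvg (B + S) S (x + (v + u))) ≤
          ∑ x ∈ B, (1 - hAvg (B + S) S (x + v)) +
          ∑ x ∈ B, |hAvg (B + S) S (x + v) - hAvg (B + S) S (x + (u + v))| := by
        rw [← Finset.sum_add_distrib]
        apply Finset.sum_le_sum
        intro x _
        rw [add_comm v u]
        linarith [le_abs_self (hAvg (B + S) S (x + v) - hAvg (B + S) S (x + (u + v)))]
      push_cast
      linarith
  refine ⟨Y w - Y w, ?_, ?_, ?_, ?_⟩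
  · obtain ⟨x, hx⟩ := hYne
    have := Finset.sub_mem_sub hx hx
    rwa [sub_self] at this
  · rw [neg_sub]
  · intro t ht
    have h1 := hpath m t ht
    have h2 : (m : ℝ) * (#B / (2 * m)) = #B / 2 := by field_simp
    rw [h2, Finset.sum_sub_distrib] at h1
    simp only [Finset.sum_const, nsmul_eq_mul, mul_one] at h1
    have h3 : 0 < ∑ x ∈ B, hAvg (B + S) S (x + t) := by linarith
    obtain ⟨x, hx, hpos⟩ := Finset.exists_lt_of_sum_lt
      (f := fun _ => (0 : ℝ)) (g := fun x => hAvg (B + S) S (x + t)) (s := B) (by simpa using h3)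
    have h4 : 0 < ∑ s ∈ S, if x + t + s ∈ B + S then (1 : ℝ) else 0 := by
      by_contra hcon
      have : hAvg (B + S) S (x + t) ≤ 0 := by
        unfold hAvg
        exact div_nonpos_of_nonpos_of_nonneg (not_lt.mp hcon) hSc.le
      linarith
    obtain ⟨s, hs, hspos⟩ := Finset.exists_lt_of_sum_lt
      (f := fun _ => (0 : ℝ)) (g := fun s => if x + t + s ∈ B + S then (1 : ℝ) else 0) (s := S)
      (by simpa using h4)
    have h5 : x + t + s ∈ B + S := by
      by_contra hcon
      simp [hcon] at hspos
    have h6 := Finset.sub_mem_sub (Finset.sub_mem_sub h5 hs) hx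
    have : x + t + s - s - x = t := by abel
    rwa [this] at h6
  · refine hw.trans ?_
    exact_mod_cast Finset.card_le_card_sub_right hYne

lemma pl_bound {G : Type} [AddCommGroup G] [DecidableEq G] (A : Finset G) (hA : A.Nonempty)
    (L : ℝ) (hK : (#(A + A) : ℝ) ≤ Real.exp L * #A) (m n : ℕ) :
    (#(m • A - n • A) : ℝ) ≤ Real.exp ((m + n : ℝ) * L) * #A := by
  have hAc : (0 : ℝ) < #A := by exact_mod_cast hA.card_pos
  have h := Finset.pluennecke_ruzsa_inequality_nsmul_sub_nsmul_add hA A m n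
  have h' : (#(m • A - n • A) : ℝ) ≤ ((#(A + A) : ℝ) / #A) ^ (m + n) * #A := by
    have h2 := (NNRat.cast_le (K := ℝ)).mpr h
    push_cast at h2
    exact h2
  refine h'.trans ?_
  have h2 : Real.exp ((m + n : ℝ) * L) = (Real.exp L) ^ (m + n) := by
    rw [← Real.exp_nat_mul]; push_cast; rfl
  rw [h2]
  have : (#(A + A) : ℝ) / #A ≤ Real.exp L := by rwa [div_le_iff₀ hAc]
  gcongr

lemma growth_pigeon (f : ℕ → ℝ) (q : ℝ) (n : ℕ) (hn : 0 < n)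
    (h : f n ≤ Real.exp (n * q) * f 0) : ∃ l < n, f (l + 1) ≤ Real.exp q * f l := by
  by_contra hcon
  push Not at hcon
  have key : ∀ l ≤ n, Real.exp (l * q) * f 0 ≤ f l ∧ (0 < l → Real.exp (l * q) * f 0 < f l) := by
    intro l
    induction l with
    | zero => intro _; simp
    | succ l ih =>
      intro hl
      have h1 := (ih (by omega)).1
      have h2 := hcon l (by omega)
      have h3 : Real.exp (((l + 1 : ℕ) : ℝ) * q) * f 0 < f (l + 1) := by
        refine lt_of_le_of_lt ?_ h2
        have : Real.exp (((l + 1 : ℕ) : ℝ) * q) = Real.exp q * Real.exp (l * q) := by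
          rw [← Real.exp_add]; congr 1; push_cast; ring
        rw [this, mul_assoc]
        gcongr
      exact ⟨h3.le, fun _ => h3⟩
  have := (key n le_rfl).2 hn
  linarith

lemma base_step {G : Type} [AddCommGroup G] [DecidableEq G] (A : Finset G) (hA : A.Nonempty)
    (L : ℝ) (hL : 2 ≤ 3 * L) (hK : (#(A + A) : ℝ) ≤ Real.exp L * #A) (m : ℕ) (hm : 0 < m) :
    ∃ T : Finset G, (0 : G) ∈ T ∧ -T = T ∧ m • T ⊆ 2 • (A - A) ∧
      Real.exp (-(6240 * (m : ℝ) ^ 2 * L ^ 2 + 1)) * #A ≤ #T := by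
  have hm' : (1 : ℝ) ≤ m := by exact_mod_cast hm
  have hU : (#(A + A - A) : ℝ) ≤ Real.exp (3 * L) * #A := by
    have := pl_bound A hA L hK 2 1
    rw [two_nsmul, one_nsmul] at this
    convert this using 3
    norm_num
  set k := ⌈64 * (m : ℝ) ^ 2 * (3 * L + 2)⌉₊ with hk
  obtain ⟨T, h0, hs, hsub, hc⟩ := croot_sisask A A A hA hA hA m k hm L (3 * L) (by linarith)
    hU hK (Nat.le_ceil _)
  refine ⟨T, h0, hs, ?_, le_trans ?_ hc⟩
  · refine hsub.trans (subset_of_eq ?_)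
    rw [two_nsmul]
    simp only [sub_eq_add_neg]
    ac_rfl
  · have hk2 : (k : ℝ) ≤ 64 * (m : ℝ) ^ 2 * (3 * L + 2) + 1 :=
      (Nat.ceil_lt_add_one (by positivity)).le
    have hm2 : (1 : ℝ) ≤ (m : ℝ) ^ 2 := one_le_pow₀ hm'
    have : (k : ℝ) * L ≤ 6240 * (m : ℝ) ^ 2 * L ^ 2 := by
      have : (k : ℝ) ≤ 6240 * (m : ℝ) ^ 2 * L := by nlinarith
      nlinarith
    gcongr

lemma iter_step {G : Type} [AddCommGroup G] [DecidableEq G] (A : Finset G) (hA : A.Nonempty)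
    (L : ℝ) (hL : 2 ≤ 3 * L) (hK : (#(A + A) : ℝ) ≤ Real.exp L * #A)
    (T : Finset G) (h0 : (0 : G) ∈ T) (hsym : -T = T) (i m : ℕ) (D : ℝ) (hm : 0 < m)
    (hsub : m • T ⊆ (2 * i) • (A - A)) (hc : Real.exp (-D) * #A ≤ #T)
    (m' : ℕ) (hm' : 0 < m') :
    ∃ T' : Finset G, (0 : G) ∈ T' ∧ -T' = T' ∧ m' • T' ⊆ (2 * i + 2) • (A - A) ∧
      Real.exp (-(D + (6240 * (m' : ℝ) ^ 2 * (i + 1) ^ 2 * L ^ 2 / m + 1))) * #A ≤ #T' := by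
  have hmr : (1 : ℝ) ≤ m := by exact_mod_cast hm
  have hm'r : (1 : ℝ) ≤ m' := by exact_mod_cast hm'
  have hir : (0 : ℝ) ≤ i := by positivity
  have hTne : T.Nonempty := ⟨0, h0⟩
  have mono : ∀ j ≤ m, j • T ⊆ (2 * i) • A - (2 * i) • A := by
    intro j hj
    rw [← nsmul_sub]
    exact (Finset.nsmul_subset_nsmul_right h0 hj).trans hsub
  have hneg : ∀ l : ℕ, -(l • T) = l • T := by
    intro l; rw [← neg_nsmul, hsym]
  set n := (m + 3) / 4 with hn
  have hn0 : 0 < n := by omega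
  have hnr : (m : ℝ) ≤ 4 * n := by
    have : m ≤ 4 * n := by omega
    exact_mod_cast this
  have hn0r : (0 : ℝ) < n := by exact_mod_cast hn0
  obtain ⟨l, hl, hgr⟩ := growth_pigeon (fun l => (#(A + l • T) : ℝ))
    ((4 * i + 1) * L / n) n hn0 (by
      have h1 := pl_bound A hA L hK (2 * i + 1) (2 * i)
      have h2 : A + n • T ⊆ (2 * i + 1) • A - (2 * i) • A := by
        refine (Finset.add_subset_add_left (mono n (by omega))).trans (subset_of_eq ?_)
        rw [succ_nsmul]
        simp only [sub_eq_add_neg]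
        ac_rfl
      have h3 : (#(A + n • T) : ℝ) ≤ #((2 * i + 1) • A - (2 * i) • A) := by
        exact_mod_cast Finset.card_le_card h2
      have h4 : (n : ℝ) * ((4 * i + 1) * L / n) = (4 * i + 1) * L := by field_simp
      simp only [zero_nsmul, add_zero]
      rw [h4]
      refine h3.trans (h1.trans (le_of_eq ?_))
      congr 2; push_cast; ring)
  set B := A + l • T with hB
  have hBne : B.Nonempty := hA.add ⟨0, Finset.zero_mem_nsmul h0⟩
  have hBT : (#(B + T) : ℝ) ≤ Real.exp ((4 * i + 1) * L / n) * #B := by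
    rwa [hB, add_assoc, ← succ_nsmul]
  have hU : (#(B + B - B) : ℝ) ≤ Real.exp ((4 * i + 3) * L) * #B := by
    have e1 : B + B - B = 2 • A - A + (3 * l) • T := by
      have : (3 * l) • T = l • T + l • T + l • T := by
        rw [← add_nsmul, ← add_nsmul]; congr 1; ring
      rw [this, hB, two_nsmul]
      simp only [sub_eq_add_neg, neg_add, hneg]
      ac_rfl
    have e2 : B + B - B ⊆ (2 * i + 2) • A - (2 * i + 1) • A := by
      rw [e1]
      refine (Finset.add_subset_add_left (mono _ (by omega))).trans (subset_of_eq ?_)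
      rw [succ_nsmul A (2 * i), add_nsmul]
      simp only [sub_eq_add_neg, neg_add]
      ac_rfl
    have h1 := pl_bound A hA L hK (2 * i + 2) (2 * i + 1)
    have h3 : (#(B + B - B) : ℝ) ≤ #((2 * i + 2) • A - (2 * i + 1) • A) := by
      exact_mod_cast Finset.card_le_card e2
    have h4 : (#A : ℝ) ≤ #B := by
      exact_mod_cast Finset.card_le_card_add_right ⟨0, Finset.zero_mem_nsmul h0⟩
    refine h3.trans (h1.trans ?_)
    have h5 : (((2 * i + 2 : ℕ) : ℝ) + ((2 * i + 1 : ℕ) : ℝ)) * L = (4 * i + 3) * L := by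
      push_cast; ring
    rw [h5]
    gcongr
  have hL0 : 0 < L := by linarith
  set k := ⌈64 * (m' : ℝ) ^ 2 * ((4 * i + 3) * L + 2)⌉₊ with hk
  obtain ⟨T', h0', hs', hsub', hc'⟩ := croot_sisask B B T hBne hBne hTne m' k hm'
    ((4 * i + 1) * L / n) ((4 * i + 3) * L) (by positivity) hU hBT (Nat.le_ceil _)
  refine ⟨T', h0', hs', hsub'.trans ?_, le_trans ?_ hc'⟩
  · have e1 : B + B - B - B = 2 • (A - A) + (4 * l) • T := by
      have : (4 * l) • T = l • T + l • T + l • T + l • T := by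
        rw [← add_nsmul, ← add_nsmul, ← add_nsmul]; congr 1; ring
      rw [this, hB, two_nsmul]
      simp only [sub_eq_add_neg, neg_add, hneg]
      ac_rfl
    rw [e1, add_nsmul, add_comm]
    apply Finset.add_subset_add_right
    exact (Finset.nsmul_subset_nsmul_right h0 (by omega)).trans hsub
  · have hk2 : (k : ℝ) ≤ 64 * (m' : ℝ) ^ 2 * ((4 * i + 3) * L + 2) + 1 :=
      (Nat.ceil_lt_add_one (by positivity)).le
    have hm2 : (1 : ℝ) ≤ (m' : ℝ) ^ 2 := one_le_pow₀ hm'r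
    have hk3 : (k : ℝ) ≤ 390 * (m' : ℝ) ^ 2 * (i + 1) * L := by
      have a1 : (4 * i + 3) * L + 2 ≤ 6 * ((i + 1) * L) := by nlinarith
      have a2 : 1 ≤ (m' : ℝ) ^ 2 * (6 * ((i + 1) * L)) := by
        have a3 : 2 / 3 ≤ (i + 1) * L := by nlinarith
        nlinarith
      nlinarith
    have hq : (4 * i + 1) * L / n ≤ 16 * (i + 1) * L / m := by
      rw [div_le_div_iff₀ hn0r (by linarith)]
      have : (4 * (i : ℝ) + 1) * L * m ≤ (4 * i + 1) * L * (4 * n) := by gcongr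
      nlinarith [mul_pos hL0 hn0r]
    have hka : (k : ℝ) * ((4 * i + 1) * L / n) ≤
        6240 * (m' : ℝ) ^ 2 * (i + 1) ^ 2 * L ^ 2 / m := by
      calc (k : ℝ) * ((4 * i + 1) * L / n)
          ≤ (390 * (m' : ℝ) ^ 2 * (i + 1) * L) * (16 * (i + 1) * L / m) := by
            apply mul_le_mul hk3 hq (by positivity) (by positivity)
        _ = _ := by ring
    rw [neg_add, Real.exp_add]
    have h6 : Real.exp (-(6240 * (m' : ℝ) ^ 2 * (i + 1) ^ 2 * L ^ 2 / m + 1)) ≤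
        Real.exp (-(k * ((4 * i + 1) * L / n) + 1)) := by
      apply Real.exp_le_exp.mpr; linarith
    calc _ = Real.exp (-(6240 * (m' : ℝ) ^ 2 * (i + 1) ^ 2 * L ^ 2 / m + 1)) *
          (Real.exp (-D) * #A) := by ring
      _ ≤ _ := by gcongr

lemma sqrt_seq (lam : ℝ) (hlam : 1 ≤ lam) (m : ℕ) (hm : 0 < m) (e : ℝ)
    (he : lam ^ (1 - e) ≤ m) :
    ∃ m' : ℕ, 0 < m' ∧ (m' : ℝ) ^ 2 ≤ 4 * lam * m ∧ lam ^ (1 - e / 2) ≤ m' := by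
  have hmr : (1 : ℝ) ≤ m := by exact_mod_cast hm
  have hx : 1 ≤ lam * m := by nlinarith
  have hs : 1 ≤ √(lam * m) := by rwa [Real.one_le_sqrt]
  have hsq : √(lam * m) ^ 2 = lam * m := Real.sq_sqrt (by linarith)
  refine ⟨⌈√(lam * m)⌉₊, Nat.ceil_pos.mpr (by linarith), ?_, ?_⟩
  · have h1 : (⌈√(lam * m)⌉₊ : ℝ) ≤ 2 * √(lam * m) := by
      have := (Nat.ceil_lt_add_one (show 0 ≤ √(lam * m) by linarith)).le
      linarith
    calc (⌈√(lam * m)⌉₊ : ℝ) ^ 2 ≤ (2 * √(lam * m)) ^ 2 := by gcongr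
      _ = 4 * lam * m := by rw [mul_pow, hsq]; ring
  · refine le_trans ?_ (Nat.le_ceil _)
    apply Real.le_sqrt_of_sq_le
    have h0 : 0 < lam := by linarith
    calc (lam ^ (1 - e / 2)) ^ 2 = lam * lam ^ (1 - e) := by
          rw [← Real.rpow_natCast, ← Real.rpow_mul h0.le]
          nth_rewrite 2 [← Real.rpow_one lam]
          rw [← Real.rpow_add h0]
          congr 1; push_cast; ring
      _ ≤ lam * m := by gcongr

lemma iterate {G : Type} [AddCommGroup G] [DecidableEq G] (A : Finset G) (hA : A.Nonempty)
    (L : ℝ) (hL : 2 ≤ 3 * L) (hK : (#(A + A) : ℝ) ≤ Real.exp L * #A) (lam : ℝ) (hlam : 1 ≤ lam)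
    (J : ℕ) :
    ∃ (m : ℕ) (T : Finset G), 0 < m ∧ (0 : G) ∈ T ∧ -T = T ∧
      m • T ⊆ (2 * (J + 1)) • (A - A) ∧ lam ^ (1 - (1 / 2 : ℝ) ^ (J + 1)) ≤ m ∧
      Real.exp (-((J + 1) * (24960 * lam * (J + 1) ^ 2 * L ^ 2 + 1))) * #A ≤ #T := by
  induction J with
  | zero =>
    obtain ⟨m, hm, hm2, hml⟩ := sqrt_seq lam hlam 1 one_pos 1 (by simp)
    obtain ⟨T, h0, hs, hsub, hc⟩ := base_step A hA L hL hK m hm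
    refine ⟨m, T, hm, h0, hs, by simpa using hsub, by simpa using hml, le_trans ?_ hc⟩
    have : 6240 * (m : ℝ) ^ 2 * L ^ 2 ≤ 24960 * lam * L ^ 2 := by
      have : 6240 * (m : ℝ) ^ 2 ≤ 24960 * lam := by push_cast at hm2; linarith
      gcongr
    gcongr
    push_cast
    linarith
  | succ J ih =>
    obtain ⟨m, T, hm, h0, hs, hsub, hml, hc⟩ := ih
    obtain ⟨m', hm', hm2, hml'⟩ := sqrt_seq lam hlam m hm _ hml
    obtain ⟨T', h0', hs', hsub', hc'⟩ := iter_step A hA L hL hK T h0 hs (J + 1) m _ hm hsub hc m' hm'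
    refine ⟨m', T', hm', h0', hs', hsub', ?_, le_trans ?_ hc'⟩
    · convert hml' using 3
      rw [pow_succ]; ring
    · have hmr : (0 : ℝ) < m := by exact_mod_cast hm
      have h1 : 6240 * (m' : ℝ) ^ 2 * (((J + 1 : ℕ) : ℝ) + 1) ^ 2 * L ^ 2 / m ≤
          24960 * lam * (((J + 1 : ℕ) : ℝ) + 1) ^ 2 * L ^ 2 := by
        rw [div_le_iff₀ hmr]
        calc 6240 * (m' : ℝ) ^ 2 * (((J + 1 : ℕ) : ℝ) + 1) ^ 2 * L ^ 2
            ≤ 6240 * (4 * lam * m) * (((J + 1 : ℕ) : ℝ) + 1) ^ 2 * L ^ 2 := by gcongr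
          _ = _ := by ring
      have h2 : 24960 * lam * ((J : ℝ) + 1) ^ 2 * L ^ 2 ≤
          24960 * lam * (((J + 1 : ℕ) : ℝ) + 1) ^ 2 * L ^ 2 := by
        have : (J : ℝ) + 1 ≤ ((J + 1 : ℕ) : ℝ) + 1 := by push_cast; linarith
        gcongr
      have h3 := mul_le_mul_of_nonneg_left h2 (show (0 : ℝ) ≤ J + 1 by positivity)
      have h4 : (J : ℝ) + 1 = ((J + 1 : ℕ) : ℝ) := by push_cast; ring
      rw [h4] at h3
      gcongr
      rw [h4]
      nlinarith

lemma J_facts (r : ℕ) (hr : 3 ≤ r) : ∃ J : ℕ, 2 * (J + 1) ≤ r ∧ (1 / 2 : ℝ) ^ (J + 1) ≤ 2 / r ∧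
    ((J : ℝ) + 1) ^ 3 ≤ 4 * r := by
  have h1 : 1 ≤ Nat.log 2 r := Nat.log_pos (by norm_num) (by omega)
  obtain ⟨J, hJ⟩ : ∃ J, Nat.log 2 r = J + 1 := ⟨Nat.log 2 r - 1, by omega⟩
  have hlo : 2 ^ (J + 1) ≤ r := by rw [← hJ]; exact Nat.pow_log_le_self 2 (by omega)
  have hhi : r < 2 ^ (J + 2) := by
    have := Nat.lt_pow_succ_log_self (b := 2) (by norm_num) r
    rwa [hJ] at this
  refine ⟨J, ?_, ?_, ?_⟩
  · rcases J with _ | _ | J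
    · omega
    · simpa using hlo
    · have : ∀ J : ℕ, 2 * (J + 2 + 1) ≤ 2 ^ (J + 2 + 1) := by
        intro J
        induction J with
        | zero => norm_num
        | succ J ih => rw [show J + 1 + 2 + 1 = (J + 2 + 1) + 1 by ring, pow_succ]; linarith
      exact (this J).trans hlo
  · have hr0 : (0 : ℝ) < r := by positivity
    rw [one_div, inv_pow, inv_eq_one_div, div_le_div_iff₀ (by positivity) hr0]
    have : (r : ℝ) ≤ 2 ^ (J + 2) := by exact_mod_cast hhi.le
    rw [pow_succ] at this
    linarith
  · have : ∀ J : ℕ, (J + 1) ^ 3 ≤ 4 * 2 ^ (J + 1) := by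
      intro J
      rcases lt_or_ge J 4 with h | h
      · interval_cases J <;> norm_num
      · induction J, h using Nat.le_induction with
        | base => norm_num
        | succ J h ih =>
          have : (J + 1 + 1) ^ 3 ≤ 2 * (J + 1) ^ 3 := by
            obtain ⟨t, rfl⟩ := Nat.exists_eq_add_of_le h
            have : 2 * (4 + t + 1) ^ 3 = (4 + t + 1 + 1) ^ 3 +
              (t ^ 3 + 12 * t ^ 2 + 42 * t + 34) := by ring
            omega
          calc _ ≤ _ := this
            _ ≤ 2 * (4 * 2 ^ (J + 1)) := by omega
            _ = _ := by ring
    have h2 : (J + 1) ^ 3 ≤ 4 * r := (this J).trans (by omega)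
    exact_mod_cast h2

lemma coe_iterSum {G : Type} [AddCommGroup G] [DecidableEq G] (n : ℕ) (T : Finset G) :
    iterSum n (T : Set G) = ((n • T : Finset G) : Set G) := by
  induction n with
  | zero => rw [iterSum, zero_nsmul, Finset.coe_zero]; rfl
  | succ n ih => rw [iterSum, ih, succ_nsmul', Finset.coe_add]

lemma lower_m (C : ℝ) (hC : 2 ≤ C) (s r : ℕ) (hs : 1 ≤ s) (hr : 3 ≤ r) (L : ℝ) (hL : 2 ≤ 3 * L)
    (d : ℝ) (hd : d ≤ 1 / 2) (hdr : d ≤ 2 / r) :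
    (1 / 2 : ℝ) ^ C * s * r * L ^ (1 - C / r) ≤ ((s : ℝ) ^ 2 * r ^ 2 * L) ^ (1 - d) ∨ d < 0 := by
  rcases lt_or_ge d 0 with h | hd0
  · right; exact h
  left
  have hsr : (1 : ℝ) ≤ s := by exact_mod_cast hs
  have hrr : (3 : ℝ) ≤ r := by exact_mod_cast hr
  have hL0 : 0 < L := by linarith
  have h1 : ((s : ℝ) ^ 2 * r ^ 2 * L) ^ (1 - d) = ((s : ℝ) * r) ^ (2 * (1 - d)) * L ^ (1 - d) := by
    rw [← mul_pow, Real.mul_rpow (by positivity) hL0.le, ← Real.rpow_natCast,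
      ← Real.rpow_mul (by positivity)]
    norm_num
  have h2 : (s : ℝ) * r ≤ ((s : ℝ) * r) ^ (2 * (1 - d)) := by
    apply Real.self_le_rpow_of_one_le
    · nlinarith
    · linarith
  have hCr : d ≤ C / r := hdr.trans (by gcongr)
  have hCr' : C / r ≤ C := div_le_self (by linarith) (by linarith)
  have h3 : (1 / 2 : ℝ) ^ C * L ^ (1 - C / r) ≤ L ^ (1 - d) := by
    have e1 : L ^ (1 - C / r) = L ^ (1 - d) * L ^ (-(C / r - d)) := by
      rw [← Real.rpow_add hL0]; congr 1; ring
    have e2 : L ^ (-(C / r - d)) ≤ (1 / 2 : ℝ) ^ (-(C / r - d)) :=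
      Real.rpow_le_rpow_of_nonpos (by norm_num) (by linarith) (by linarith)
    have e3 : (1 / 2 : ℝ) ^ C * (1 / 2 : ℝ) ^ (-(C / r - d)) ≤ 1 := by
      rw [← Real.rpow_add (by norm_num)]
      exact Real.rpow_le_one (by norm_num) (by norm_num) (by linarith)
    have e4 : (0 : ℝ) ≤ L ^ (1 - d) := by positivity
    calc (1 / 2 : ℝ) ^ C * L ^ (1 - C / r)
        = L ^ (1 - d) * ((1 / 2 : ℝ) ^ C * L ^ (-(C / r - d))) := by rw [e1]; ring
      _ ≤ L ^ (1 - d) * ((1 / 2 : ℝ) ^ C * (1 / 2 : ℝ) ^ (-(C / r - d))) := by gcongr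
      _ ≤ L ^ (1 - d) * 1 := by gcongr
      _ = _ := mul_one _
  rw [h1]
  calc (1 / 2 : ℝ) ^ C * s * r * L ^ (1 - C / r)
      = (s * r) * ((1 / 2 : ℝ) ^ C * L ^ (1 - C / r)) := by ring
    _ ≤ _ := by gcongr

lemma cost_bound (s r : ℕ) (hs : 1 ≤ s) (hr : 3 ≤ r) (L : ℝ) (hL : 2 ≤ 3 * L) (j : ℝ)
    (hj : 1 ≤ j) (hjr : j ^ 3 ≤ 4 * r) :
    j * (24960 * ((s : ℝ) ^ 2 * r ^ 2 * L) * j ^ 2 * L ^ 2 + 1) ≤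
      1000000 * (s : ℝ) ^ 2 * (r : ℝ) ^ 3 * L ^ 3 := by
  have hsr : (1 : ℝ) ≤ s := by exact_mod_cast hs
  have hrr : (3 : ℝ) ≤ r := by exact_mod_cast hr
  have hL0 : 0 < L := by linarith
  have h1 : j ≤ j ^ 3 := by nlinarith [sq_nonneg (j - 1)]
  have hL3 : 8 / 27 ≤ L ^ 3 := by
    have : (2 / 3 : ℝ) ^ 3 ≤ L ^ 3 := by gcongr; linarith
    linarith
  have hs2 : (1 : ℝ) ≤ (s : ℝ) ^ 2 := one_le_pow₀ hsr
  have hr2 : (9 : ℝ) ≤ (r : ℝ) ^ 2 := by nlinarith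
  have h2 : 1 ≤ (s : ℝ) ^ 2 * r ^ 2 * L ^ 3 := by
    calc (1 : ℝ) ≤ 1 * 9 * (8 / 27) := by norm_num
      _ ≤ _ := by gcongr
  calc j * (24960 * ((s : ℝ) ^ 2 * r ^ 2 * L) * j ^ 2 * L ^ 2 + 1)
      = j ^ 3 * (24960 * ((s : ℝ) ^ 2 * r ^ 2 * L ^ 3)) + j := by ring
    _ ≤ (4 * r) * (24960 * ((s : ℝ) ^ 2 * r ^ 2 * L ^ 3)) +
        (4 * r) * ((s : ℝ) ^ 2 * r ^ 2 * L ^ 3) := by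
        have : j ≤ (4 * r) * ((s : ℝ) ^ 2 * r ^ 2 * L ^ 3) := by nlinarith
        gcongr
    _ ≤ _ := by
      have : (0 : ℝ) ≤ (s : ℝ) ^ 2 * (r : ℝ) ^ 3 * L ^ 3 := by positivity
      nlinarith

end Helpers

/-- Proposition 5.8, Konyagin-type refinement. -/
theorem statement9 :
    ∃ C c : ℝ, 0 < C ∧ 0 < c ∧
      ∀ (G : Type) [AddCommGroup G] [Fintype G], ∀ (A : Set G) (K : ℝ) (r s : ℕ),
        A.Nonempty → haar (A + A) ≤ K * haar A → 3 ≤ r →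
        ∃ (m : ℕ) (T : Set G),
          c * (s : ℝ) * (r : ℝ) * Real.log (2 * K) ^ (1 - C / (r : ℝ)) ≤ (m : ℝ) ∧
          (0 : G) ∈ T ∧ T = -T ∧
          iterSum m T ⊆ iterSum r (A - A) ∧
          Real.exp (-(C * (s : ℝ) ^ 2 * (r : ℝ) ^ 3 * Real.log (2 * K) ^ 3)) * haar A ≤
            haar T := by
  refine ⟨1000000, (1 / 2 : ℝ) ^ (1000000 : ℝ), by norm_num, by positivity, ?_⟩
  intro G _ _ A K r s hA hK hr
  classical
  obtain ⟨F, rfl⟩ : ∃ F : Finset G, (F : Set G) = A := ⟨A.toFinset, by simp⟩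
  have hF : F.Nonempty := by simpa using hA
  have hG : (0 : ℝ) < Fintype.card G := by exact_mod_cast Fintype.card_pos
  have hhaar : ∀ S : Finset G, haar (S : Set G) = (S.card : ℝ) / Fintype.card G := by
    intro S; simp [haar]
  have hFc : (0 : ℝ) < F.card := by exact_mod_cast hF.card_pos
  rw [← Finset.coe_add, hhaar, hhaar, ← mul_div_assoc, div_le_div_iff_of_pos_right hG] at hK
  have hK1 : 1 ≤ K := by
    have : (F.card : ℝ) ≤ (F + F).card := by
      exact_mod_cast Finset.card_le_card_add_right hF
    by_contra hcon
    nlinarith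
  set L := Real.log (2 * K) with hLdef
  have hL : 2 ≤ 3 * L := by
    have : Real.log 2 ≤ L := Real.log_le_log (by norm_num) (by linarith)
    linarith [Real.log_two_gt_d9]
  have hK' : ((F + F).card : ℝ) ≤ Real.exp L * F.card := by
    rw [hLdef, Real.exp_log (by linarith)]
    nlinarith
  have h00 : (0 : G) ∈ F - F := by
    obtain ⟨x, hx⟩ := hF
    have := Finset.sub_mem_sub hx hx
    rwa [sub_self] at this
  rw [← Finset.coe_sub, coe_iterSum]
  rcases Nat.eq_zero_or_pos s with rfl | hs
  · refine ⟨0, ((Finset.univ : Finset G) : Set G), by simp, by simp, by simp, ?_, ?_⟩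
    · rw [coe_iterSum, Finset.coe_subset, zero_nsmul]
      intro x hx
      rw [Finset.mem_zero] at hx
      subst hx
      exact Finset.zero_mem_nsmul h00
    · rw [hhaar, hhaar]
      simp only [Nat.cast_zero, ne_eq, OfNat.ofNat_ne_zero, not_false_eq_true, zero_pow,
        mul_zero, zero_mul, neg_zero, Real.exp_zero, one_mul]
      have : (F.card : ℝ) ≤ (Finset.univ : Finset G).card := by
        exact_mod_cast Finset.card_le_card (Finset.subset_univ F)
      gcongr
  · obtain ⟨J, hJ1, hJ2, hJ3⟩ := J_facts r hr
    have hsr : (1 : ℝ) ≤ s := by exact_mod_cast hs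
    have hrr : (3 : ℝ) ≤ r := by exact_mod_cast hr
    have hlam : 1 ≤ (s : ℝ) ^ 2 * r ^ 2 * L := by
      have h1 : (1 : ℝ) ≤ (s : ℝ) ^ 2 := one_le_pow₀ hsr
      have h2 : (3 : ℝ) ^ 2 ≤ (r : ℝ) ^ 2 := by gcongr
      have h3 : 2 / 3 ≤ L := by linarith
      calc (1 : ℝ) ≤ 1 * 3 ^ 2 * (2 / 3) := by norm_num
        _ ≤ _ := by gcongr
    obtain ⟨m, T, hm, h0, hsym, hsub, hml, hc⟩ := iterate F hF L hL hK' _ hlam J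
    refine ⟨m, (T : Set G), ?_, by simpa using h0, ?_, ?_, ?_⟩
    · refine le_trans ?_ hml
      have hp : (0 : ℝ) ≤ (1 / 2 : ℝ) ^ (J + 1) := by positivity
      have hp2 : (1 / 2 : ℝ) ^ (J + 1) ≤ 1 / 2 :=
        pow_le_of_le_one (by norm_num) (by norm_num) (by omega)
      rcases lower_m 1000000 (by norm_num) s r hs hr L hL _ hp2 hJ2 with h | h
      · exact h
      · linarith
    · rw [← Finset.coe_neg, hsym]
    · rw [coe_iterSum, Finset.coe_subset]
      exact hsub.trans (Finset.nsmul_subset_nsmul_right h00 hJ1)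
    · rw [hhaar, hhaar, ← mul_div_assoc, div_le_div_iff_of_pos_right hG]
      refine le_trans ?_ hc
      have := cost_bound s r hs hr L hL (J + 1) (by linarith [Nat.cast_nonneg (α := ℝ) J]) hJ3
      gcongr

end Paper
end

section
/- There is an absolute constant C > 0 such that the following holds. Let G be a finite abelian group and suppose A ⊆ G is (m,l)-arithmetically connected for some m, l ∈ ℕ. Then ‖1_A ∗ 1_A‖²_{L₂(m_G)} ≥ m^{−C·l}·m_G(A)³. -/
open scoped BigOperators Pointwise ENNReal ENat
open Real

namespace Paper

section Helpers
open Finset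

lemma fiber_sq {P G : Type*} [DecidableEq G] [Fintype G] (S : Finset P) (f : P → G) :
    ∑ x : G, (#{p ∈ S | f p = x}) ^ 2 = #{w ∈ S ×ˢ S | f w.1 = f w.2} := by
  rw [Finset.card_eq_sum_card_fiberwise (f := fun w : P × P => f w.1) (t := Finset.univ)
    (by intro x _; simp)]
  refine Finset.sum_congr rfl fun x _ => ?_
  rw [sq, ← Finset.card_product]
  congr 1
  ext ⟨p, q⟩
  simp only [Finset.mem_product, Finset.mem_filter]
  constructor
  · rintro ⟨⟨h1, h2⟩, h3, h4⟩
    exact ⟨⟨⟨h1, h3⟩, by rw [h2, h4]⟩, h2⟩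
  · rintro ⟨⟨⟨h1, h3⟩, h5⟩, h2⟩
    exact ⟨⟨h1, h2⟩, h3, by rw [← h5, h2]⟩

lemma fiber_cs {P G : Type*} [AddCommGroup G] [DecidableEq G] [Fintype G] (S : Finset P)
    (f : P → G) (A : Finset G) (z : G) :
    (#{p ∈ S | f p + z ∈ A}) ^ 2 ≤ #A * #{w ∈ S ×ˢ S | f w.1 = f w.2} := by
  rw [← fiber_sq]
  have h1 : #{p ∈ S | f p + z ∈ A} = ∑ c ∈ A, #{p ∈ S | f p = c - z} := by
    rw [Finset.card_eq_sum_card_fiberwise (f := fun p => f p + z) (t := A)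
      (by intro x hx; simp at hx; exact hx.2)]
    refine Finset.sum_congr rfl fun c hc => ?_
    congr 1
    ext p
    simp only [Finset.mem_filter]
    constructor
    · rintro ⟨⟨h1, h2⟩, h3⟩
      exact ⟨h1, by rw [← h3]; simp⟩
    · rintro ⟨h1, h2⟩
      have : f p + z = c := by rw [h2]; simp
      exact ⟨⟨h1, by rwa [this]⟩, this⟩
  rw [h1]
  refine sq_sum_le_card_mul_sum_sq.trans ?_
  refine Nat.mul_le_mul_left _ ?_
  calc ∑ c ∈ A, #{p ∈ S | f p = c - z} ^ 2 ≤ ∑ c : G, #{p ∈ S | f p = c - z} ^ 2 :=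
        Finset.sum_le_sum_of_subset (Finset.subset_univ _)
    _ = ∑ x : G, #{p ∈ S | f p = x} ^ 2 :=
        Equiv.sum_comp (Equiv.subRight z) (fun x => #{p ∈ S | f p = x} ^ 2)

/-- The additive energy of `A`. -/
def energy {G : Type*} [AddCommGroup G] [DecidableEq G] (A : Finset G) : ℕ :=
  #{w ∈ (A ×ˢ A) ×ˢ (A ×ˢ A) | w.1.1 + w.1.2 = w.2.1 + w.2.2}

lemma energy_signs {G : Type*} [AddCommGroup G] [DecidableEq G] (A : Finset G) (s t : ℤ)
    (hs : s.natAbs = 1) (ht : t.natAbs = 1) :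
    #{w ∈ (A ×ˢ A) ×ˢ (A ×ˢ A) | s • w.1.1 + t • w.1.2 = s • w.2.1 + t • w.2.2} ≤ energy A := by
  unfold energy
  have hsw : ∀ w : (G × G) × (G × G), w.1.1 - w.1.2 = w.2.1 - w.2.2 →
      w.1.1 + w.2.2 = w.2.1 + w.1.2 := by
    intro w h
    rw [sub_eq_sub_iff_add_eq_add] at h
    exact h
  have hinj : Function.Injective
      (fun w : (G × G) × (G × G) => ((w.1.1, w.2.2), (w.2.1, w.1.2))) := by
    rintro ⟨⟨a, b⟩, c, d⟩ ⟨⟨a', b'⟩, c', d'⟩ h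
    simp at h
    simp [h]
  rcases Int.natAbs_eq_iff.mp hs with rfl | rfl <;> rcases Int.natAbs_eq_iff.mp ht with rfl | rfl
  · simp
  · refine Finset.card_le_card_of_injOn _ ?_ hinj.injOn
    intro w hw
    simp [← sub_eq_add_neg] at hw ⊢
    exact ⟨⟨⟨hw.1.1.1, hw.1.2.2⟩, hw.1.2.1, hw.1.1.2⟩, hsw w hw.2⟩
  · refine Finset.card_le_card_of_injOn _ ?_ hinj.injOn
    intro w hw
    simp at hw ⊢
    refine ⟨⟨⟨hw.1.1.1, hw.1.2.2⟩, hw.1.2.1, hw.1.1.2⟩, hsw w ?_⟩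
    have := congrArg Neg.neg hw.2
    simpa [sub_eq_add_neg, add_comm] using this
  · refine Finset.card_le_card ?_
    intro w hw
    simp at hw ⊢
    refine ⟨hw.1, ?_⟩
    have := congrArg Neg.neg hw.2
    simpa [add_comm] using this

/-- Steps of size one in `ℤ^m`. -/
def stepSet (m : ℕ) : Finset (Fin m → ℤ) :=
  {0} ∪ (Finset.univ.image fun i => Pi.single i (1 : ℤ)) ∪
    (Finset.univ.image fun i => Pi.single i (-1 : ℤ))

lemma card_stepSet (m : ℕ) : #(stepSet m) ≤ 2 * m + 1 := by
  unfold stepSet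
  refine (Finset.card_union_le _ _).trans ?_
  have h1 := Finset.card_union_le ({0} : Finset (Fin m → ℤ))
    (Finset.univ.image fun i => Pi.single i (1 : ℤ))
  have h2 : #(Finset.univ.image fun i : Fin m => (Pi.single i (1 : ℤ) : Fin m → ℤ)) ≤ m := by
    simpa using Finset.card_image_le (s := (Finset.univ : Finset (Fin m)))
      (f := fun i : Fin m => (Pi.single i (1 : ℤ) : Fin m → ℤ))
  have h3 : #(Finset.univ.image fun i : Fin m => (Pi.single i (-1 : ℤ) : Fin m → ℤ)) ≤ m := by
    simpa using Finset.card_image_le (s := (Finset.univ : Finset (Fin m)))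
      (f := fun i : Fin m => (Pi.single i (-1 : ℤ) : Fin m → ℤ))
  simp only [Finset.card_singleton] at h1
  omega

lemma mem_steps {m : ℕ} (l : ℕ) : ∀ σ : Fin m → ℤ, ∑ i, (σ i).natAbs ≤ l →
    σ ∈ l • stepSet m := by
  induction l with
  | zero =>
    intro σ h
    have : σ = 0 := by
      ext i
      have := Finset.sum_eq_zero_iff.mp (Nat.le_zero.mp h) i (Finset.mem_univ _)
      simpa using this
    simp [this]
  | succ l ih =>
    intro σ h
    rw [succ_nsmul, Finset.mem_add]
    by_cases h0 : σ = 0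
    · refine ⟨0, ih 0 (by simp), 0, by simp [stepSet], by simp [h0]⟩
    · obtain ⟨i, hi⟩ : ∃ i, σ i ≠ 0 := by
        by_contra! hh
        exact h0 (funext hh)
      obtain ⟨s, hs, hs'⟩ : ∃ s : ℤ, (s = 1 ∨ s = -1) ∧ (σ i - s).natAbs + 1 = (σ i).natAbs := by
        rcases lt_or_gt_of_ne hi with h | h
        · exact ⟨-1, Or.inr rfl, by omega⟩
        · exact ⟨1, Or.inl rfl, by omega⟩
      refine ⟨σ - Pi.single i s, ih _ ?_, Pi.single i s, ?_, by simp⟩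
      · rw [← Finset.add_sum_erase _ _ (Finset.mem_univ i)] at h ⊢
        have : ∑ x ∈ Finset.univ.erase i, ((σ - Pi.single i s : Fin m → ℤ) x).natAbs
            = ∑ x ∈ Finset.univ.erase i, (σ x).natAbs := by
          refine Finset.sum_congr rfl fun k hk => ?_
          simp [Finset.ne_of_mem_erase hk]
        rw [this]
        simp
        omega
      · rcases hs with rfl | rfl <;> simp [stepSet]

lemma count_sigma {G : Type*} [AddCommGroup G] [DecidableEq G] [Fintype G] (A : Finset G)
    (m : ℕ) (σ : Fin m → ℤ) (i j : Fin m) (hij : i ≠ j)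
    (hi : (σ i).natAbs = 1) (hj : (σ j).natAbs = 1) :
    #{x ∈ Fintype.piFinset (fun _ : Fin m => A) | ∑ k, σ k • x k ∈ A} ≤
      Nat.sqrt (#A * energy A) * #A ^ (m - 2) := by
  set F := {x ∈ Fintype.piFinset (fun _ : Fin m => A) | ∑ k, σ k • x k ∈ A} with hF
  let f : (Fin m → G) → (Fin m → G) := fun x k => if k = i ∨ k = j then 0 else x k
  have hsum : ∀ x : Fin m → G, ∑ k, σ k • x k = (σ i • x i + σ j • x j) + ∑ k, σ k • f x k := by
    intro x
    have h1 : ∀ k, σ k • x k = (if k = i then σ i • x i else 0) + (if k = j then σ j • x j else 0)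
        + σ k • f x k := by
      intro k
      by_cases h1 : k = i
      · subst h1; simp [f, hij]
      · by_cases h2 : k = j
        · subst h2; simp [f, h1]
        · simp [f, h1, h2]
    rw [Finset.sum_congr rfl fun k _ => h1 k]
    simp [Finset.sum_add_distrib]
  refine (Finset.card_le_mul_card_image (f := f) F (Nat.sqrt (#A * energy A)) ?_).trans ?_
  · intro y _
    rw [Nat.le_sqrt']
    have key := (fiber_cs (A ×ˢ A) (fun p : G × G => σ i • p.1 + σ j • p.2) A
      (∑ k, σ k • y k)).trans (Nat.mul_le_mul_left _ (energy_signs A _ _ hi hj))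
    refine le_trans (Nat.pow_le_pow_left ?_ 2) key
    refine Finset.card_le_card_of_injOn (fun x => (x i, x j)) ?_ ?_
    · intro x hx
      simp [hF] at hx
      simp only [Finset.coe_filter, Finset.mem_product, Set.mem_ofPred_eq]
      refine ⟨⟨hx.1.1 i, hx.1.1 j⟩, ?_⟩
      rw [← hx.2, ← hsum]
      exact hx.1.2
    · intro x hx x' hx' h
      simp at hx hx' h
      ext k
      by_cases h1 : k = i
      · rw [h1, h.1]
      · by_cases h2 : k = j
        · rw [h2, h.2]
        · have := congrFun (hx.2.trans hx'.2.symm) k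
          simpa [f, h1, h2] using this
  · refine Nat.mul_le_mul_left _ ?_
    have hsub : F.image f ⊆ Fintype.piFinset (fun k => if k = i ∨ k = j then {0} else A) := by
      intro y hy
      obtain ⟨x, hx, rfl⟩ := Finset.mem_image.mp hy
      simp [hF] at hx
      rw [Fintype.mem_piFinset]
      intro k
      by_cases h1 : k = i ∨ k = j
      · simp [f, h1]
      · simp only [f, h1, if_false]; exact hx.1 k
    refine (Finset.card_le_card hsub).trans (le_of_eq ?_)
    rw [Fintype.card_piFinset]
    have : ∀ k, #(if k = i ∨ k = j then ({0} : Finset G) else A)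
        = if k ∈ ({i, j} : Finset (Fin m)) then 1 else #A := by
      intro k
      by_cases h1 : k = i ∨ k = j <;> simp [h1]
    rw [Finset.prod_congr rfl fun k _ => this k, Finset.prod_ite]
    simp only [Finset.prod_const, one_pow, one_mul]
    congr 1
    rw [Finset.filter_not, Finset.filter_mem_eq_inter, Finset.univ_inter,
      Finset.card_sdiff_of_subset (Finset.subset_univ _), Finset.card_pair hij]
    simp

lemma main_count {G : Type} [AddCommGroup G] [DecidableEq G] [Fintype G] (A : Finset G)
    (m l : ℕ) (h : ArithConnected m l (A : Set G)) (hA : A.Nonempty) :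
    2 ≤ m ∧ #A ^ 3 ≤ ((2 * m + 1) ^ l) ^ 2 * energy A := by
  have hm : 2 ≤ m := by
    obtain ⟨a, ha⟩ := hA
    obtain ⟨σ, _, ⟨i, j, hij, _⟩, _⟩ := h (fun _ => a) (fun _ => ha)
    have := i.2
    have := j.2
    have : i.1 ≠ j.1 := fun hh => hij (Fin.ext hh)
    omega
  refine ⟨hm, ?_⟩
  set M := Nat.sqrt (#A * energy A)
  set K := (2 * m + 1) ^ l
  have hpos : 0 < #A := hA.card_pos
  set T := {σ ∈ l • stepSet m | ∃ i j, i ≠ j ∧ (σ i).natAbs = 1 ∧ (σ j).natAbs = 1}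
  have hT : #T ≤ K :=
    (Finset.card_filter_le _ _).trans
      (Finset.card_nsmul_le.trans (Nat.pow_le_pow_left (card_stepSet m) l))
  have hcov : Fintype.piFinset (fun _ : Fin m => A) ⊆ T.biUnion
      (fun σ => {x ∈ Fintype.piFinset (fun _ : Fin m => A) | ∑ k, σ k • x k ∈ A}) := by
    intro x hx
    obtain ⟨σ, h1, h2, h3⟩ := h x (fun i => by simpa using Fintype.mem_piFinset.mp hx i)
    rw [Finset.mem_biUnion]
    exact ⟨σ, Finset.mem_filter.mpr ⟨mem_steps l σ h1, h2⟩,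
      Finset.mem_filter.mpr ⟨hx, by simpa using h3⟩⟩
  have h1 : #A ^ m ≤ K * (M * #A ^ (m - 2)) := by
    calc #A ^ m = #(Fintype.piFinset (fun _ : Fin m => A)) := by
          rw [Fintype.card_piFinset]; simp
      _ ≤ _ := Finset.card_le_card hcov
      _ ≤ #T * (M * #A ^ (m - 2)) := by
          refine Finset.card_biUnion_le_card_mul _ _ _ ?_
          intro σ hσ
          obtain ⟨_, i, j, hij, hi, hj⟩ := Finset.mem_filter.mp hσ
          exact count_sigma A m σ i j hij hi hj
      _ ≤ _ := Nat.mul_le_mul_right _ hT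
  have h2 : #A ^ 2 ≤ K * M := by
    refine Nat.le_of_mul_le_mul_right ?_ (pow_pos hpos (m - 2))
    rw [← pow_add, mul_assoc]
    rwa [Nat.add_sub_cancel' hm]
  have h3 : M ^ 2 ≤ #A * energy A := Nat.sqrt_le' _
  refine Nat.le_of_mul_le_mul_right ?_ hpos
  calc #A ^ 3 * #A = (#A ^ 2) ^ 2 := by ring
    _ ≤ (K * M) ^ 2 := Nat.pow_le_pow_left h2 2
    _ = K ^ 2 * M ^ 2 := by ring
    _ ≤ K ^ 2 * (#A * energy A) := Nat.mul_le_mul_left _ h3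
    _ = K ^ 2 * energy A * #A := by ring

lemma conv_energy {G : Type} [AddCommGroup G] [DecidableEq G] [Fintype G] (A : Finset G) :
    (Fintype.card G : ℝ)⁻¹ * ∑ x : G, convFun ((A : Set G).indicator (1 : G → ℝ))
      ((A : Set G).indicator (1 : G → ℝ)) x ^ 2 = energy A / (Fintype.card G : ℝ) ^ 3 := by
  have hr : ∀ x : G, ∑ y, (A : Set G).indicator (1 : G → ℝ) y *
      (A : Set G).indicator (1 : G → ℝ) (x - y) =
      (#{p ∈ A ×ˢ A | p.1 + p.2 = x} : ℕ) := by
    intro x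
    have : #{p ∈ A ×ˢ A | p.1 + p.2 = x} = #{y : G | y ∈ A ∧ x - y ∈ A} := by
      refine Finset.card_bij' (fun p _ => p.1) (fun y _ => (y, x - y)) ?_ ?_ ?_ ?_
      · rintro ⟨a, b⟩ h
        simp at h ⊢
        rw [← h.2]
        simpa using h.1
      · intro y h
        simp at h ⊢
        exact h
      · rintro ⟨a, b⟩ h
        simp at h ⊢
        rw [← h.2]
        simp
      · intro y h
        rfl
    rw [this, Finset.card_filter]
    push_cast
    refine Finset.sum_congr rfl fun y _ => ?_
    by_cases h1 : y ∈ A <;> by_cases h2 : x - y ∈ A <;> simp [h1, h2]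
  have he : (energy A : ℝ) = ∑ x : G, ((#{p ∈ A ×ˢ A | p.1 + p.2 = x} : ℕ) : ℝ) ^ 2 := by
    have := fiber_sq (A ×ˢ A) (fun p : G × G => p.1 + p.2)
    unfold energy
    rw [← this]
    push_cast
    rfl
  rw [he]
  simp only [convFun, hr, mul_pow]
  rw [← Finset.mul_sum]
  have : (Fintype.card G : ℝ) ≠ 0 := by
    simp
  field_simp

end Helpers

/-- Lemma 6.1, arithmetic connectivity gives additive structure. -/
theorem statement10 :
    ∃ C : ℝ, 0 < C ∧
      ∀ (G : Type) [AddCommGroup G] [Fintype G], ∀ (A : Set G) (m l : ℕ),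
        ArithConnected m l A →
        (m : ℝ) ^ (-(C * (l : ℝ))) * haar A ^ 3 ≤
          (Fintype.card G : ℝ)⁻¹ *
            ∑ x : G, convFun (A.indicator (1 : G → ℝ)) (A.indicator (1 : G → ℝ)) x ^ 2 := by
  refine ⟨6, by norm_num, ?_⟩
  intro G _ _ S m l h
  classical
  obtain ⟨A, rfl⟩ : ∃ A : Finset G, (A : Set G) = S := ⟨S.toFinset, by simp⟩
  rw [conv_energy]
  have hc : haar (A : Set G) = (A.card : ℝ) / Fintype.card G := by
    simp [haar]
  rw [hc]
  rcases A.eq_empty_or_nonempty with rfl | hA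
  · simp
    positivity
  obtain ⟨hm, hmain⟩ := main_count A m l h hA
  have hG : (0 : ℝ) < (Fintype.card G : ℝ) ^ 3 := by
    have : 0 < Fintype.card G := Fintype.card_pos
    positivity
  rw [div_pow, ← mul_div_assoc]
  refine div_le_div_of_nonneg_right ?_ hG.le
  have hm0 : (0 : ℝ) < m := by
    have : 0 < m := by omega
    exact_mod_cast this
  have hK : ((2 * m + 1) ^ l) ^ 2 ≤ m ^ (6 * l) := by
    have : 2 * m + 1 ≤ m ^ 3 := by nlinarith [Nat.mul_le_mul hm hm]
    calc ((2 * m + 1) ^ l) ^ 2 ≤ ((m ^ 3) ^ l) ^ 2 := by gcongr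
      _ = m ^ (6 * l) := by rw [← pow_mul, ← pow_mul]; ring_nf
  have h2 : A.card ^ 3 ≤ m ^ (6 * l) * energy A := hmain.trans (Nat.mul_le_mul_right _ hK)
  have h3 : (A.card : ℝ) ^ 3 ≤ (m : ℝ) ^ (6 * l) * energy A := by exact_mod_cast h2
  have h4 : (m : ℝ) ^ (-(6 * (l : ℝ))) = ((m : ℝ) ^ (6 * l))⁻¹ := by
    rw [Real.rpow_neg hm0.le, ← Real.rpow_natCast]
    push_cast
    rfl
  rw [h4, inv_mul_le_iff₀ (by positivity)]
  exact h3

end Paper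
end

section
/- There are absolute constants C' > 0 and C > 0 such that the following holds. Let G be a finite abelian group, M ≥ 1, and ε ∈ (0,1/2) with ε ≤ exp(−C'·M). If g : G → ℂ is ε-almost integer-valued with ‖g‖_{A(G)} ≤ M, then there are natural numbers m ≤ C·M³ and l ≤ C·M such that supp g_ℤ is (m,l)-arithmetically connected. -/
open scoped BigOperators Pointwise ENNReal ENat
open Real

namespace Paper

section Helpers

open Finset

lemma fourier_inv {G : Type} [AddCommGroup G] [Fintype G] (g : G → ℂ) (x : G) :
    g x = ∑ γ : AddChar G ℂ, fourierCoeff g γ * γ x := by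
  classical
  have hcard : (Fintype.card G : ℂ) ≠ 0 := by simp
  have h1 : ∀ γ : AddChar G ℂ, fourierCoeff g γ * γ x
      = ∑ y, (Fintype.card G : ℂ)⁻¹ * g y * γ (x - y) := by
    intro γ
    unfold fourierCoeff
    rw [mul_assoc, Finset.sum_mul, Finset.mul_sum]
    refine Finset.sum_congr rfl fun y _ => ?_
    rw [sub_eq_add_neg, AddChar.map_add_eq_mul, AddChar.map_neg_eq_conj]
    ring
  simp_rw [h1]
  rw [Finset.sum_comm]
  simp_rw [← Finset.mul_sum, AddChar.sum_apply_eq_ite, sub_eq_zero]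
  simp
  field_simp

lemma choose_xi (a b : ℤ) (ha : a ≠ 0) : ∃ ξ : ℂ, ‖ξ‖ = 1 ∧
    1 / 2 ≤ ((ξ * a + (starRingEnd ℂ) ξ * b) / 2).re
      + ((ξ * a + (starRingEnd ℂ) ξ * b) / 2).im := by
  have key : ∀ z : ℤ, z ≠ 0 → (1 : ℝ) ≤ z ∨ (1 : ℝ) ≤ -z := by
    intro z hz
    rcases lt_or_gt_of_ne hz with h | h
    · right
      have : (1 : ℤ) ≤ -z := by omega
      exact_mod_cast this
    · left
      have : (1 : ℤ) ≤ z := by omega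
      exact_mod_cast this
  by_cases h : a + b = 0
  · have hb : b = -a := by omega
    subst hb
    rcases key a ha with h1 | h1
    · refine ⟨Complex.I, by simp, ?_⟩
      simp
      linarith
    · refine ⟨-Complex.I, by simp, ?_⟩
      simp
      linarith
  · rcases key _ h with h1 | h1
    · refine ⟨1, by simp, ?_⟩
      simp
      push_cast at h1
      linarith
    · refine ⟨-1, by simp, ?_⟩
      simp
      push_cast at h1
      linarith

/-- The real function `Re (ξ γ(x))` expanded in a power. -/
lemma re_pow {G : Type} [AddCommGroup G] [Fintype G] (γ : AddChar G ℂ) (ξ : ℂ) (x : G) (a : ℕ) :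
    (((ξ * γ x).re : ℝ) : ℂ) ^ a = ∑ j ∈ range (a + 1),
      (ξ ^ j * (starRingEnd ℂ) ξ ^ (a - j) * (a.choose j : ℂ) / 2 ^ a)
        * γ ((2 * (j : ℤ) - a) • x) := by
  rw [Complex.re_eq_add_conj, div_pow, add_pow, Finset.sum_div]
  refine Finset.sum_congr rfl fun j hj => ?_
  have hj' : j ≤ a := by simpa [Nat.lt_succ_iff] using hj
  obtain ⟨b, rfl⟩ := Nat.exists_eq_add_of_le hj'
  have e : (2 * (j : ℤ) - ((j + b : ℕ) : ℤ)) • x = j • x + b • (-x) := by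
    rw [← natCast_zsmul, ← natCast_zsmul, zsmul_neg, ← neg_zsmul, ← add_zsmul]
    congr 1
    push_cast
    ring
  rw [e, AddChar.map_add_eq_mul, AddChar.map_nsmul_eq_pow, AddChar.map_nsmul_eq_pow,
    AddChar.map_neg_eq_conj, map_mul, mul_pow, mul_pow]
  simp
  ring

lemma addChar_sum {G : Type} [AddCommGroup G] {m : ℕ} (γ : AddChar G ℂ) (y : Fin m → G) :
    γ (∑ i, y i) = ∏ i, γ (y i) := by
  classical
  have : ∀ s : Finset (Fin m), γ (∑ i ∈ s, y i) = ∏ i ∈ s, γ (y i) := by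
    intro s
    induction s using Finset.induction_on with
    | empty => simp
    | insert i s hi ih => rw [Finset.sum_insert hi, Finset.prod_insert hi,
        AddChar.map_add_eq_mul, ih]
  exact this _

lemma phi_bound {G : Type} [AddCommGroup G] [Fintype G] {m : ℕ} (c : AddChar G ℂ → ℂ)
    (g : G → ℂ) (hg : ∀ x, g x = ∑ γ, c γ * γ x) (ξ : Fin m → ℂ) (hξ : ∀ i, ‖ξ i‖ = 1)
    (x : Fin m → G) (α : Fin m → ℕ) (δ : ℝ)
    (h : ∀ σ : Fin m → ℤ, (∀ i, (σ i).natAbs ≤ α i) → (∀ i, α i = 1 → (σ i).natAbs = 1) →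
      ‖g (∑ i, σ i • x i)‖ ≤ δ) :
    ‖∑ γ, c γ * ∏ i, (((ξ i * γ (x i)).re : ℝ) : ℂ) ^ α i‖ ≤ δ := by
  classical
  set K : (i : Fin m) → ℕ → ℂ := fun i j =>
    ξ i ^ j * (starRingEnd ℂ) (ξ i) ^ (α i - j) * ((α i).choose j : ℂ) / 2 ^ α i with hK
  have h1 : ∑ γ, c γ * ∏ i, (((ξ i * γ (x i)).re : ℝ) : ℂ) ^ α i
      = ∑ j ∈ Fintype.piFinset (fun i => range (α i + 1)),
        (∏ i, K i (j i)) * g (∑ i, (2 * (j i : ℤ) - α i) • x i) := by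
    have : ∀ γ : AddChar G ℂ, c γ * ∏ i, (((ξ i * γ (x i)).re : ℝ) : ℂ) ^ α i
        = ∑ j ∈ Fintype.piFinset (fun i => range (α i + 1)),
          (∏ i, K i (j i)) * (c γ * γ (∑ i, (2 * (j i : ℤ) - α i) • x i)) := by
      intro γ
      simp_rw [re_pow]
      rw [Finset.prod_univ_sum, Finset.mul_sum]
      refine Finset.sum_congr rfl fun j _ => ?_
      rw [addChar_sum, Finset.prod_mul_distrib]
      ring
    simp_rw [this]
    rw [Finset.sum_comm]
    refine Finset.sum_congr rfl fun j _ => ?_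
    rw [← Finset.mul_sum, ← hg]
  rw [h1]
  have h2 : ∀ j ∈ Fintype.piFinset (fun i => range (α i + 1)),
      ‖(∏ i, K i (j i)) * g (∑ i, (2 * (j i : ℤ) - α i) • x i)‖
        ≤ (∏ i, (((α i).choose (j i) : ℝ) / 2 ^ α i)) * δ := by
    intro j hj
    rw [norm_mul, norm_prod]
    have hj' : ∀ i, j i ≤ α i := by
      intro i
      have := Fintype.mem_piFinset.1 hj i
      simpa [Nat.lt_succ_iff] using this
    have e : ∀ i, ‖K i (j i)‖ = ((α i).choose (j i) : ℝ) / 2 ^ α i := by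
      intro i
      simp [hK, hξ]
    simp_rw [e]
    refine mul_le_mul_of_nonneg_left ?_ (Finset.prod_nonneg fun i _ => by positivity)
    apply h
    · intro i
      have := hj' i
      omega
    · intro i hi
      have := hj' i
      omega
  refine (norm_sum_le _ _).trans ((Finset.sum_le_sum h2).trans ?_)
  rw [← Finset.sum_mul, ← Finset.prod_univ_sum (fun i => range (α i + 1))
    (fun i j => ((α i).choose j : ℝ) / 2 ^ α i)]
  have : ∀ i, ∑ j ∈ range (α i + 1), ((α i).choose j : ℝ) / 2 ^ α i = 1 := by
    intro i
    rw [← Finset.sum_div]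
    have := Nat.sum_range_choose (α i)
    have h' : (∑ j ∈ range (α i + 1), ((α i).choose j : ℝ)) = 2 ^ α i := by exact_mod_cast this
    rw [h']
    field_simp
  simp [this]

/-- The index set of multi-indices of total degree `< n`. -/
def idx (m n : ℕ) : Finset (Fin m → ℕ) :=
  (Fintype.piFinset fun _ => range n).filter fun α => ∑ i, α i < n

lemma exp_trunc {m n : ℕ} (f : Fin m → ℂ) :
    ∑ k ∈ range n, (∑ i, f i) ^ k / (k.factorial : ℂ)
      = ∑ α ∈ idx m n, ∏ i, (f i ^ α i / ((α i).factorial : ℂ)) := by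
  classical
  have hm : ∀ α ∈ idx m n, ∑ i, α i ∈ range n := by
    intro α hα
    simpa [idx] using (Finset.mem_filter.1 hα).2
  rw [← Finset.sum_fiberwise_of_maps_to hm]
  refine Finset.sum_congr rfl fun k hk => ?_
  have hk' : k < n := by simpa using hk
  have hset : (idx m n).filter (fun α => ∑ i, α i = k) = Finset.piAntidiag univ k := by
    ext α
    simp only [idx, Finset.mem_filter, Fintype.mem_piFinset, Finset.mem_range,
      Finset.mem_piAntidiag, Finset.mem_univ, implies_true, and_true]
    constructor
    · exact fun h => h.2
    · intro h
      have h' : ∑ i, α i = k := h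
      refine ⟨⟨fun i => ?_, by omega⟩, h⟩
      have := Finset.single_le_sum (f := α) (fun j _ => Nat.zero_le _) (Finset.mem_univ i)
      omega
  rw [hset, Finset.sum_pow_eq_sum_piAntidiag, Finset.sum_div]
  refine Finset.sum_congr rfl fun α hα => ?_
  have hs : ∑ i, α i = k := (Finset.mem_piAntidiag.1 hα).1
  have hsp := Nat.multinomial_spec univ α
  rw [hs] at hsp
  have hsp' : (∏ i, ((α i).factorial : ℂ)) * (Nat.multinomial univ α : ℂ) = (k.factorial : ℂ) := by
    exact_mod_cast hsp
  rw [Finset.prod_div_distrib, ← hsp']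
  have h1 : (∏ i, ((α i).factorial : ℂ)) ≠ 0 :=
    Finset.prod_ne_zero_iff.2 fun i _ => by exact_mod_cast Nat.factorial_ne_zero _
  have h2 : (Nat.multinomial univ α : ℂ) ≠ 0 := by
    exact_mod_cast (Nat.multinomial_pos _ _).ne'
  field_simp

/-- The weight of a multi-index. -/
noncomputable def wt {m : ℕ} (y : ℝ) (α : Fin m → ℕ) : ℝ := ∏ i, (y ^ α i / ((α i).factorial : ℝ))

lemma wt_nonneg {m : ℕ} {y : ℝ} (hy : 0 ≤ y) (α : Fin m → ℕ) : 0 ≤ wt y α :=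
  Finset.prod_nonneg fun i _ => by positivity

lemma wt_single {m : ℕ} (y : ℝ) (i : Fin m) : wt y (Pi.single i 1) = y := by
  classical
  unfold wt
  rw [Finset.prod_eq_single i]
  · simp
  · intro j _ hj
    simp [hj]
  · simp

lemma wt_total {m n : ℕ} {y : ℝ} (hy : 0 ≤ y) : ∑ α ∈ idx m n, wt y α ≤ Real.exp (m * y) := by
  calc ∑ α ∈ idx m n, wt y α ≤ ∑ α ∈ Fintype.piFinset (fun _ : Fin m => range n), wt y α :=
        Finset.sum_le_sum_of_subset_of_nonneg (Finset.filter_subset _ _)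
          fun α _ _ => wt_nonneg hy α
    _ = ∏ _i : Fin m, ∑ a ∈ range n, y ^ a / (a.factorial : ℝ) := by
        rw [Finset.prod_univ_sum]
        rfl
    _ ≤ ∏ _i : Fin m, Real.exp y := by
        refine Finset.prod_le_prod (fun i _ => Finset.sum_nonneg fun a _ => by positivity)
          fun i _ => Real.sum_le_exp_of_nonneg hy n
    _ = Real.exp (m * y) := by
        rw [Finset.prod_const, Finset.card_univ, Fintype.card_fin, ← Real.exp_nat_mul]

/-- A multi-index with at least two entries equal to one. -/
def TwoOnes {m : ℕ} (α : Fin m → ℕ) : Prop := ∃ i j, i ≠ j ∧ α i = 1 ∧ α j = 1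

/-- Multi-indices with entries `< n` and different from `1`. -/
def noOnes (n : ℕ) : Finset ℕ := (range n).erase 1

lemma noOnes_sum_le {n : ℕ} (hn : 2 ≤ n) {y : ℝ} (hy : 0 ≤ y) (hy1 : y ≤ 1) :
    ∑ a ∈ noOnes n, y ^ a / (a.factorial : ℝ) ≤ 1 + y ^ 2 := by
  have h1 := Real.sum_le_exp_of_nonneg hy n
  have h2 : y ^ 1 / ((1 : ℕ).factorial : ℝ) + ∑ a ∈ noOnes n, y ^ a / (a.factorial : ℝ)
      = ∑ a ∈ range n, y ^ a / (a.factorial : ℝ) :=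
    Finset.add_sum_erase (range n) (fun a => y ^ a / (a.factorial : ℝ)) (by simp; omega)
  have h3 := Real.abs_exp_sub_one_sub_id_le (x := y) (by rw [abs_of_nonneg hy]; exact hy1)
  have h4 := (abs_le.1 h3).2
  simp at h2
  linarith

lemma wt_bad {m n : ℕ} (hn : 2 ≤ n) {y : ℝ} (hy : 0 ≤ y) (hy1 : y ≤ 1)
    (B : Finset (Fin m → ℕ)) (hB : B ⊆ idx m n)
    (hB2 : ∀ α ∈ B, ¬ TwoOnes α) (hB3 : ∀ α ∈ B, ∀ i, α ≠ Pi.single i 1) :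
    ∑ α ∈ B, wt y α ≤ (1 + y ^ 2) ^ m + m * (y * ((1 + y ^ 2) ^ m - 1)) := by
  classical
  set P0 : Finset (Fin m → ℕ) := Fintype.piFinset fun _ => noOnes n with hP0
  set P : Fin m → Finset (Fin m → ℕ) := fun i =>
    Fintype.piFinset (Function.update (fun _ => noOnes n) i {1}) with hP
  have hq0 : 0 ≤ ∑ a ∈ noOnes n, y ^ a / (a.factorial : ℝ) :=
    Finset.sum_nonneg fun a _ => by positivity
  have hq := noOnes_sum_le hn hy hy1
  have hsub : B ⊆ P0 ∪ Finset.univ.biUnion fun i => (P i).erase (Pi.single i 1) := by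
    intro α hα
    have hlt : ∀ i, α i < n := fun i => by
      have := Fintype.mem_piFinset.1 (Finset.mem_filter.1 (hB hα)).1 i
      simpa using this
    by_cases h : ∃ i, α i = 1
    · obtain ⟨i, hi⟩ := h
      refine Finset.mem_union_right _ (Finset.mem_biUnion.2 ⟨i, Finset.mem_univ _, ?_⟩)
      refine Finset.mem_erase.2 ⟨hB3 α hα i, ?_⟩
      refine Fintype.mem_piFinset.2 fun j => ?_
      by_cases hj : j = i
      · subst hj
        simp [hi]
      · rw [Function.update_of_ne hj]
        refine Finset.mem_erase.2 ⟨fun h1 => hB2 α hα ⟨j, i, hj, h1, hi⟩, by simpa using hlt j⟩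
    · push Not at h
      refine Finset.mem_union_left _ (Fintype.mem_piFinset.2 fun j => ?_)
      exact Finset.mem_erase.2 ⟨h j, by simpa using hlt j⟩
  have hS0 : ∑ α ∈ P0, wt y α ≤ (1 + y ^ 2) ^ m := by
    have : ∑ α ∈ P0, wt y α = ∏ _i : Fin m, ∑ a ∈ noOnes n, y ^ a / (a.factorial : ℝ) := by
      rw [Finset.prod_univ_sum]
      rfl
    rw [this, Finset.prod_const, Finset.card_univ, Fintype.card_fin]
    exact pow_le_pow_left₀ hq0 hq _
  have hSi : ∀ i, ∑ α ∈ (P i).erase (Pi.single i 1), wt y α ≤ y * ((1 + y ^ 2) ^ m - 1) := by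
    intro i
    have hmem : (Pi.single i 1 : Fin m → ℕ) ∈ P i := by
      refine Fintype.mem_piFinset.2 fun j => ?_
      by_cases hj : j = i
      · subst hj
        simp
      · rw [Function.update_of_ne hj]
        refine Finset.mem_erase.2 ⟨by simp [hj], ?_⟩
        simp [hj]
        omega
    have h1 := Finset.add_sum_erase (P i) (fun α => wt y α) hmem
    have h2 : ∑ α ∈ P i, wt y α ≤ y * (1 + y ^ 2) ^ m := by
      have e : ∑ α ∈ P i, wt y α = ∏ j : Fin m,
          ∑ a ∈ (Function.update (fun _ => noOnes n) i {1} : Fin m → Finset ℕ) j,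
            y ^ a / (a.factorial : ℝ) := by
        rw [Finset.prod_univ_sum]
        rfl
      rw [e, ← Finset.mul_prod_erase _ _ (Finset.mem_univ i)]
      have e1 : ∑ a ∈ (Function.update (fun _ => noOnes n) i {1} : Fin m → Finset ℕ) i,
            y ^ a / (a.factorial : ℝ) = y := by simp
      rw [e1]
      refine mul_le_mul_of_nonneg_left ?_ hy
      calc ∏ j ∈ univ.erase i,
          ∑ a ∈ (Function.update (fun _ => noOnes n) i {1} : Fin m → Finset ℕ) j,
            y ^ a / (a.factorial : ℝ)
          ≤ ∏ j ∈ univ.erase i, (1 + y ^ 2) := by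
            refine Finset.prod_le_prod
              (fun j _ => Finset.sum_nonneg fun a _ => by positivity) fun j hj => ?_
            rw [Function.update_of_ne (Finset.ne_of_mem_erase hj)]
            exact hq
        _ = (1 + y ^ 2) ^ (univ.erase i).card := by rw [Finset.prod_const]
        _ ≤ (1 + y ^ 2) ^ m := by
            refine pow_le_pow_right₀ (by nlinarith) ?_
            refine (Finset.card_le_univ _).trans (by simp)
    simp only [wt_single] at h1
    linarith
  calc ∑ α ∈ B, wt y α
      ≤ ∑ α ∈ P0 ∪ Finset.univ.biUnion (fun i => (P i).erase (Pi.single i 1)), wt y α :=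
        Finset.sum_le_sum_of_subset_of_nonneg hsub fun α _ _ => wt_nonneg hy α
    _ ≤ ∑ α ∈ P0, wt y α
        + ∑ α ∈ Finset.univ.biUnion (fun i => (P i).erase (Pi.single i 1)), wt y α := by
        rw [← Finset.sum_union_inter]
        have : 0 ≤ ∑ α ∈ P0 ∩ Finset.univ.biUnion (fun i => (P i).erase (Pi.single i 1)),
          wt y α := Finset.sum_nonneg fun α _ => wt_nonneg hy α
        linarith
    _ ≤ ∑ α ∈ P0, wt y α + ∑ i, ∑ α ∈ (P i).erase (Pi.single i 1), wt y α := by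
        have : ∀ s : Finset (Fin m), ∑ α ∈ s.biUnion (fun i => (P i).erase (Pi.single i 1)),
            wt y α ≤ ∑ i ∈ s, ∑ α ∈ (P i).erase (Pi.single i 1), wt y α := by
          intro s
          induction s using Finset.induction_on with
          | empty => simp
          | insert i s hi ih =>
            rw [Finset.biUnion_insert, Finset.sum_insert hi]
            have h1 := Finset.sum_union_inter (s₁ := (P i).erase (Pi.single i 1))
              (s₂ := s.biUnion (fun i => (P i).erase (Pi.single i 1))) (f := fun α => wt y α)
            have h2 : 0 ≤ ∑ α ∈ (P i).erase (Pi.single i 1) ∩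
              s.biUnion (fun i => (P i).erase (Pi.single i 1)), wt y α :=
                Finset.sum_nonneg fun α _ => wt_nonneg hy α
            linarith
        have := this Finset.univ
        linarith
    _ ≤ (1 + y ^ 2) ^ m + ∑ _i : Fin m, y * ((1 + y ^ 2) ^ m - 1) :=
        add_le_add hS0 (Finset.sum_le_sum fun i _ => hSi i)
    _ = _ := by simp

/-- Truncated exponentials of imaginary numbers are bounded by two. -/
lemma trunc_bound {lam t : ℝ} {n : ℕ} (hlam : 0 ≤ lam) (hn0 : 1 ≤ n) (hn : 8 * lam ≤ n)
    (ht : |t| ≤ lam) :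
    ‖∑ k ∈ range n, (Complex.I * t) ^ k / (k.factorial : ℂ)‖ ≤ 2 := by
  have hnorm : ‖Complex.I * (t : ℂ)‖ = |t| := by simp
  have hs : (0 : ℝ) < (n.succ : ℝ) := by positivity
  have h1 := Complex.exp_bound' (x := Complex.I * (t : ℂ)) (n := n) (by
    rw [hnorm, div_le_iff₀ hs]
    push_cast
    linarith)
  rw [hnorm] at h1
  have h2 : ‖Complex.exp (Complex.I * (t : ℂ))‖ = 1 := by
    rw [mul_comm]
    exact Complex.norm_exp_ofReal_mul_I t
  have h3 : |t| ^ n / (n.factorial : ℝ) * 2 ≤ 1 := by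
    have a1 : |t| ^ n ≤ lam ^ n := pow_le_pow_left₀ (abs_nonneg _) ht n
    have a2 := Real.pow_div_factorial_le_exp (4 * lam) (by linarith) n
    have a3 : Real.exp (4 * lam) ≤ 2 ^ n := by
      calc Real.exp (4 * lam) ≤ Real.exp ((n : ℝ) * (1 / 2)) := Real.exp_le_exp.2 (by linarith)
        _ = Real.exp (1 / 2) ^ n := Real.exp_nat_mul _ _
        _ ≤ 2 ^ n := by
          refine pow_le_pow_left₀ (Real.exp_pos _).le ?_ n
          have b1 : Real.exp (1 / 2) ^ 2 = Real.exp 1 := by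
            rw [← Real.exp_nat_mul]
            norm_num
          have b2 := Real.exp_one_lt_d9
          nlinarith [Real.exp_pos (1 / 2)]
    have a4 : (2 : ℝ) ≤ 2 ^ n := by
      calc (2 : ℝ) = 2 ^ 1 := by norm_num
        _ ≤ 2 ^ n := pow_le_pow_right₀ (by norm_num) hn0
    have a5 : (4 * lam) ^ n = 2 ^ n * 2 ^ n * lam ^ n := by
      rw [← mul_pow, ← mul_pow]
      norm_num
    have hf : (0 : ℝ) < (n.factorial : ℝ) := by positivity
    rw [a5] at a2
    have a6 : 2 ^ n * (lam ^ n / (n.factorial : ℝ)) ≤ 1 := by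
      have : (2 : ℝ) ^ n * (2 ^ n * (lam ^ n / (n.factorial : ℝ))) ≤ 2 ^ n * 1 := by
        calc _ = 2 ^ n * 2 ^ n * lam ^ n / (n.factorial : ℝ) := by ring
          _ ≤ 2 ^ n * 1 := by linarith
      exact le_of_mul_le_mul_left this (by positivity)
    have a7 : |t| ^ n / (n.factorial : ℝ) ≤ lam ^ n / (n.factorial : ℝ) :=
      div_le_div_of_nonneg_right a1 hf.le
    have a8 : 0 ≤ lam ^ n / (n.factorial : ℝ) := by positivity
    nlinarith
  have h4 := norm_sub_norm_le (∑ k ∈ range n, (Complex.I * (t : ℂ)) ^ k / (k.factorial : ℂ))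
    (Complex.exp (Complex.I * (t : ℂ)))
  rw [norm_sub_rev] at h4
  linarith

lemma main_ineq {G : Type} [AddCommGroup G] [Fintype G] {m n : ℕ} (c : AddChar G ℂ → ℂ)
    (g : G → ℂ) (hg : ∀ x, g x = ∑ γ, c γ * γ x) (M ε lam : ℝ) (hc : ∑ γ, ‖c γ‖ ≤ M)
    (hε : 0 ≤ ε) (ξ : Fin m → ℂ) (hξ : ∀ i, ‖ξ i‖ = 1) (x : Fin m → G)
    (hm : 0 < m) (hn : 2 ≤ n) (hlam : 0 ≤ lam) (hlm : lam ≤ m) (hln : 8 * lam ≤ n)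
    (hgood : ∀ σ : Fin m → ℤ, (∑ i, (σ i).natAbs) ≤ n →
      (∃ i j, i ≠ j ∧ (σ i).natAbs = 1 ∧ (σ j).natAbs = 1) → ‖g (∑ i, σ i • x i)‖ ≤ ε) :
    lam / m * ‖∑ i, (ξ i * g (x i) + (starRingEnd ℂ) (ξ i) * g (-x i)) / 2‖
      ≤ 2 * M + ε * Real.exp lam
        + M * ((1 + (lam / m) ^ 2) ^ m + lam * ((1 + (lam / m) ^ 2) ^ m - 1)) := by
  classical
  have hm' : (0 : ℝ) < m := by exact_mod_cast hm
  have hM : 0 ≤ M := (Finset.sum_nonneg fun γ _ => norm_nonneg _).trans hc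
  set y : ℝ := lam / m with hy
  have hy0 : 0 ≤ y := by positivity
  have hy1 : y ≤ 1 := by rw [hy, div_le_one hm']; exact hlm
  have hmy : (m : ℝ) * y = lam := by rw [hy]; field_simp
  have hgM : ∀ z, ‖g z‖ ≤ M := by
    intro z
    rw [hg]
    refine (norm_sum_le _ _).trans (le_trans (Finset.sum_le_sum fun γ _ => ?_) hc)
    rw [norm_mul, AddChar.norm_apply, mul_one]
  set u : AddChar G ℂ → Fin m → ℝ := fun γ i => (ξ i * γ (x i)).re with hu
  have hu1 : ∀ γ i, |u γ i| ≤ 1 := by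
    intro γ i
    refine (Complex.abs_re_le_norm _).trans ?_
    rw [norm_mul, hξ, AddChar.norm_apply, mul_one]
  set Φ : (Fin m → ℕ) → ℂ := fun α => ∑ γ, c γ * ∏ i, ((u γ i : ℝ) : ℂ) ^ α i with hΦ
  have hΦM : ∀ α, ‖Φ α‖ ≤ M := fun α =>
    phi_bound c g hg ξ hξ x α M fun σ _ _ => hgM _
  have hΦε : ∀ α ∈ idx m n, TwoOnes α → ‖Φ α‖ ≤ ε := by
    intro α hα htwo
    refine phi_bound c g hg ξ hξ x α ε fun σ h1 h2 => hgood σ ?_ ?_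
    · have := (Finset.mem_filter.1 hα).2
      exact (Finset.sum_le_sum fun i _ => h1 i).trans this.le
    · obtain ⟨i, j, hij, hi, hj⟩ := htwo
      exact ⟨i, j, hij, h2 i hi, h2 j hj⟩
  -- the sum
  set A : (Fin m → ℕ) → ℂ := fun α => (∏ i, Complex.I ^ α i) * (wt y α : ℂ) * Φ α with hA
  have hAn : ∀ α, ‖A α‖ = wt y α * ‖Φ α‖ := by
    intro α
    rw [hA]
    simp only [norm_mul, norm_prod, norm_pow, Complex.norm_I, one_pow, Finset.prod_const_one,
      one_mul, Complex.norm_real, Real.norm_eq_abs, abs_of_nonneg (wt_nonneg hy0 α)]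
  have hsum : ∑ γ, c γ * ∑ k ∈ range n, (Complex.I * ((y * ∑ i, u γ i : ℝ) : ℂ)) ^ k
      / (k.factorial : ℂ) = ∑ α ∈ idx m n, A α := by
    have : ∀ γ, c γ * ∑ k ∈ range n, (Complex.I * ((y * ∑ i, u γ i : ℝ) : ℂ)) ^ k
      / (k.factorial : ℂ) = ∑ α ∈ idx m n, (∏ i, Complex.I ^ α i) * (wt y α : ℂ) *
        (c γ * ∏ i, ((u γ i : ℝ) : ℂ) ^ α i) := by
      intro γ
      have e : Complex.I * ((y * ∑ i, u γ i : ℝ) : ℂ) = ∑ i, Complex.I * y * (u γ i : ℂ) := by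
        rw [← Finset.mul_sum]
        push_cast
        ring
      rw [e, exp_trunc, Finset.mul_sum]
      refine Finset.sum_congr rfl fun α _ => ?_
      unfold wt
      push_cast
      simp_rw [mul_pow, Finset.prod_div_distrib, Finset.prod_mul_distrib]
      ring
    simp_rw [this]
    rw [Finset.sum_comm]
    refine Finset.sum_congr rfl fun α _ => ?_
    rw [← Finset.mul_sum]
  have hbound : ‖∑ α ∈ idx m n, A α‖ ≤ 2 * M := by
    rw [← hsum]
    refine (norm_sum_le _ _).trans ?_
    calc _ ≤ ∑ γ, ‖c γ‖ * 2 := by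
          refine Finset.sum_le_sum fun γ _ => ?_
          rw [norm_mul]
          refine mul_le_mul_of_nonneg_left ?_ (norm_nonneg _)
          refine trunc_bound hlam (by omega) hln ?_
          rw [abs_mul, abs_of_nonneg hy0, ← hmy, mul_comm]
          refine mul_le_mul_of_nonneg_right ?_ hy0
          refine (Finset.abs_sum_le_sum_abs _ _).trans ?_
          refine (Finset.sum_le_sum fun i _ => hu1 γ i).trans ?_
          simp
      _ ≤ 2 * M := by
          rw [← Finset.sum_mul]
          linarith
  -- linear terms
  set S1 : Finset (Fin m → ℕ) := univ.image fun i => Pi.single i 1 with hS1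
  have hS1sub : S1 ⊆ idx m n := by
    intro α hα
    obtain ⟨i, -, rfl⟩ := Finset.mem_image.1 hα
    refine Finset.mem_filter.2 ⟨Fintype.mem_piFinset.2 fun j => ?_, ?_⟩
    · by_cases hj : j = i
      · subst hj
        simp
        omega
      · simp [hj]
        omega
    · simp
      omega
  have hlin : ∑ α ∈ S1, A α = Complex.I * y *
      ∑ i, (ξ i * g (x i) + (starRingEnd ℂ) (ξ i) * g (-x i)) / 2 := by
    rw [hS1, Finset.sum_image, Finset.mul_sum]
    · refine Finset.sum_congr rfl fun i _ => ?_
      have e1 : ∏ j, Complex.I ^ (Pi.single i 1 : Fin m → ℕ) j = Complex.I := by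
        rw [Finset.prod_eq_single i]
        · simp
        · intro j _ hj
          simp [hj]
        · simp
      have e2 : Φ (Pi.single i 1) = (ξ i * g (x i) + (starRingEnd ℂ) (ξ i) * g (-x i)) / 2 := by
        rw [hΦ, hg, hg, Finset.mul_sum, Finset.mul_sum, ← Finset.sum_add_distrib, Finset.sum_div]
        refine Finset.sum_congr rfl fun γ _ => ?_
        rw [Finset.prod_eq_single i]
        · simp only [hu, Pi.single_eq_same, pow_one]
          rw [Complex.re_eq_add_conj, AddChar.map_neg_eq_conj, map_mul]
          ring
        · intro j _ hj
          simp [hj]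
        · simp
      rw [hA]
      simp only [e1, e2, wt_single]
    · intro i _ j _ hij
      by_contra hne
      have := congrFun hij i
      simp [hne] at this
  have hrest : ‖∑ α ∈ idx m n \ S1, A α‖ ≤ ε * Real.exp lam
        + M * ((1 + y ^ 2) ^ m + lam * ((1 + y ^ 2) ^ m - 1)) := by
    set B : Finset (Fin m → ℕ) := (idx m n \ S1).filter fun α => ¬ TwoOnes α with hBdef
    refine (norm_sum_le _ _).trans ?_
    rw [← Finset.sum_filter_add_sum_filter_not _ (fun α => TwoOnes α)]
    refine add_le_add ?_ ?_
    · calc _ ≤ ∑ α ∈ (idx m n \ S1).filter (fun α => TwoOnes α), ε * wt y α := by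
            refine Finset.sum_le_sum fun α hα => ?_
            rw [hAn, mul_comm]
            have h1 := Finset.mem_filter.1 hα
            exact mul_le_mul_of_nonneg_right (hΦε α (Finset.mem_sdiff.1 h1.1).1 h1.2)
              (wt_nonneg hy0 α)
        _ = ε * ∑ α ∈ (idx m n \ S1).filter (fun α => TwoOnes α), wt y α := by
            rw [Finset.mul_sum]
        _ ≤ ε * ∑ α ∈ idx m n, wt y α := by
            refine mul_le_mul_of_nonneg_left ?_ hε
            exact Finset.sum_le_sum_of_subset_of_nonneg
              ((Finset.filter_subset _ _).trans Finset.sdiff_subset) fun α _ _ => wt_nonneg hy0 α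
        _ ≤ ε * Real.exp lam := by
            refine mul_le_mul_of_nonneg_left ?_ hε
            rw [← hmy]
            exact wt_total hy0
    · calc _ ≤ ∑ α ∈ B, M * wt y α := by
            refine Finset.sum_le_sum fun α hα => ?_
            rw [hAn, mul_comm]
            exact mul_le_mul_of_nonneg_right (hΦM α) (wt_nonneg hy0 α)
        _ = M * ∑ α ∈ B, wt y α := by rw [Finset.mul_sum]
        _ ≤ _ := by
            refine mul_le_mul_of_nonneg_left ?_ hM
            have := wt_bad hn hy0 hy1 B ((Finset.filter_subset _ _).trans Finset.sdiff_subset)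
              (fun α hα => (Finset.mem_filter.1 hα).2) (fun α hα i h => by
                refine (Finset.mem_sdiff.1 (Finset.mem_filter.1 hα).1).2 ?_
                rw [h]
                exact Finset.mem_image_of_mem _ (Finset.mem_univ i))
            rw [← mul_assoc, hmy] at this
            exact this
  have hsplit := Finset.sum_sdiff (f := A) hS1sub
  have hfin : ‖∑ α ∈ S1, A α‖ ≤ 2 * M + (ε * Real.exp lam
        + M * ((1 + y ^ 2) ^ m + lam * ((1 + y ^ 2) ^ m - 1))) := by
    have : ∑ α ∈ S1, A α = ∑ α ∈ idx m n, A α - ∑ α ∈ idx m n \ S1, A α := by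
      rw [← hsplit]
      ring
    rw [this]
    exact (norm_sub_le _ _).trans (add_le_add hbound hrest)
  rw [hlin, norm_mul, norm_mul, Complex.norm_I, one_mul, Complex.norm_real, Real.norm_eq_abs,
    abs_of_nonneg hy0] at hfin
  linarith

end Helpers

/-- Proposition 6.2, small algebra norm gives arithmetic connectivity. -/
theorem statement11 :
    ∃ C' C : ℝ, 0 < C' ∧ 0 < C ∧
      ∀ (G : Type) [AddCommGroup G] [Fintype G], ∀ (M ε : ℝ) (g : G → ℂ) (gZ : G → ℤ),
        1 ≤ M → 0 < ε → ε < 1 / 2 → ε ≤ Real.exp (-(C' * M)) →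
        AlmostInt ε g gZ → wienerNorm g ≤ M →
        ∃ m l : ℕ, (m : ℝ) ≤ C * M ^ 3 ∧ (l : ℝ) ≤ C * M ∧
          ArithConnected m l {x : G | gZ x ≠ 0} := by
  classical
  refine ⟨64, 1000000, by norm_num, by norm_num, ?_⟩
  intro G _ _ M ε g gZ hM hε0 hε2 hε hint hW
  set lam : ℝ := 64 * M with hlam
  set n : ℕ := ⌈8 * lam⌉₊ with hn
  set m : ℕ := ⌈2 * lam ^ 2 * (1 + lam)⌉₊ with hm
  have hlam64 : 64 ≤ lam := by linarith
  have hn1 : 8 * lam ≤ n := Nat.le_ceil _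
  have hn2 : (n : ℝ) < 8 * lam + 1 := Nat.ceil_lt_add_one (by positivity)
  have hm1 : 2 * lam ^ 2 * (1 + lam) ≤ m := Nat.le_ceil _
  have hm2 : (m : ℝ) < 2 * lam ^ 2 * (1 + lam) + 1 := Nat.ceil_lt_add_one (by positivity)
  have hM2 : 1 ≤ M ^ 2 := one_le_pow₀ hM
  have hM3 : M ^ 2 ≤ M ^ 3 := pow_le_pow_right₀ hM (by norm_num)
  refine ⟨m, n, ?_, ?_, ?_⟩
  · have : 2 * lam ^ 2 * (1 + lam) = 8192 * M ^ 2 + 524288 * M ^ 3 := by rw [hlam]; ring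
    linarith
  · linarith
  intro x hx
  by_contra hcon
  push Not at hcon
  have hx0 : ∀ i, gZ (x i) ≠ 0 := hx
  choose ξ hξ1 hξ2 using fun i => choose_xi (gZ (x i)) (gZ (-x i)) (hx0 i)
  have hlm : lam ≤ m := by nlinarith
  have hmpos : (0 : ℝ) < m := by linarith
  have hm0 : 0 < m := by exact_mod_cast hmpos
  have hn0 : 2 ≤ n := by
    have : (2 : ℝ) ≤ n := by linarith
    exact_mod_cast this
  have hc : ∑ γ, ‖fourierCoeff g γ‖ ≤ M := by
    rw [wienerNorm, finsum_eq_sum_of_fintype] at hW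
    exact hW
  have key := main_ineq (fourierCoeff g) g (fourier_inv g) M ε lam hc hε0.le ξ hξ1 x hm0 hn0
    (by linarith) hlm hn1 (by
      intro σ h1 h2
      have h3 := hcon σ h1 h2
      have h4 : gZ (∑ i, σ i • x i) = 0 := by
        by_contra h5
        exact h3 h5
      have h5 := hint (∑ i, σ i • x i)
      rw [h4] at h5
      simpa using h5)
  -- lower bound for the linear terms
  have hε8 : ε ≤ 1 / 8 := by
    have h1 := Real.add_one_le_exp (64 * M)
    rw [Real.exp_neg] at hε
    refine hε.trans ?_
    rw [one_div]
    exact inv_anti₀ (by norm_num) (by linarith)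
  have hlow : ∀ i, 1 / 4 ≤ ((ξ i * g (x i) + (starRingEnd ℂ) (ξ i) * g (-x i)) / 2).re
      + ((ξ i * g (x i) + (starRingEnd ℂ) (ξ i) * g (-x i)) / 2).im := by
    intro i
    set w := (ξ i * g (x i) + (starRingEnd ℂ) (ξ i) * g (-x i)) / 2 with hw
    set v := (ξ i * gZ (x i) + (starRingEnd ℂ) (ξ i) * gZ (-x i)) / 2 with hv
    have hd : ‖w - v‖ ≤ ε := by
      have e : w - v = (ξ i * (g (x i) - gZ (x i))
          + (starRingEnd ℂ) (ξ i) * (g (-x i) - gZ (-x i))) / 2 := by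
        rw [hw, hv]
        ring
      rw [e, norm_div]
      have h1 := norm_add_le (ξ i * (g (x i) - gZ (x i)))
        ((starRingEnd ℂ) (ξ i) * (g (-x i) - gZ (-x i)))
      rw [norm_mul, norm_mul, RCLike.norm_conj, hξ1, one_mul, one_mul] at h1
      have h2 := hint (x i)
      have h3 := hint (-x i)
      rw [div_le_iff₀ (by norm_num)]
      norm_num
      linarith
    have h1 := (abs_le.1 ((Complex.abs_re_le_norm (w - v)).trans hd)).1
    have h2 := (abs_le.1 ((Complex.abs_im_le_norm (w - v)).trans hd)).1
    rw [Complex.sub_re] at h1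
    rw [Complex.sub_im] at h2
    have h3 := hξ2 i
    rw [← hv] at h3
    linarith
  set W := ∑ i, (ξ i * g (x i) + (starRingEnd ℂ) (ξ i) * g (-x i)) / 2 with hWdef
  have hWlow : (m : ℝ) / 8 ≤ ‖W‖ := by
    have h1 : (m : ℝ) * (1 / 4) ≤ W.re + W.im := by
      rw [hWdef, Complex.re_sum, Complex.im_sum, ← Finset.sum_add_distrib]
      calc (m : ℝ) * (1 / 4) = ∑ _i : Fin m, (1 / 4 : ℝ) := by simp
        _ ≤ _ := Finset.sum_le_sum fun i _ => hlow i
    have h2 := (le_abs_self _).trans (Complex.abs_re_le_norm W)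
    have h3 := (le_abs_self _).trans (Complex.abs_im_le_norm W)
    linarith
  have hleft : 8 * M ≤ lam / m * ‖W‖ := by
    calc 8 * M = lam / m * (m / 8) := by
          rw [hlam]
          field_simp
          norm_num
      _ ≤ _ := mul_le_mul_of_nonneg_left hWlow (by positivity)
  have hexp : ε * Real.exp lam ≤ 1 := by
    calc ε * Real.exp lam ≤ Real.exp (-(64 * M)) * Real.exp lam :=
          mul_le_mul_of_nonneg_right hε (Real.exp_pos _).le
      _ = 1 := by
          rw [← Real.exp_add, hlam]
          simp
  set t : ℝ := lam ^ 2 / m with ht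
  have ht0 : 0 ≤ t := by positivity
  have htl : t * (2 * (1 + lam)) ≤ 1 := by
    rw [ht, div_mul_eq_mul_div, div_le_one hmpos]
    linarith
  have ht1 : t ≤ 1 := by nlinarith
  have hX : (1 + (lam / m) ^ 2) ^ m ≤ 1 + 2 * t := by
    calc (1 + (lam / m) ^ 2) ^ m ≤ Real.exp ((lam / m) ^ 2) ^ m := by
          refine pow_le_pow_left₀ (by positivity) ?_ m
          have := Real.add_one_le_exp ((lam / m) ^ 2)
          linarith
      _ = Real.exp t := by
          rw [← Real.exp_nat_mul, ht]
          congr 1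
          field_simp
      _ ≤ 1 + 2 * t := by
          have h1 := Real.abs_exp_sub_one_sub_id_le (x := t) (by rw [abs_of_nonneg ht0]; exact ht1)
          have h2 := (abs_le.1 h1).2
          nlinarith
  have hY : (1 + (lam / m) ^ 2) ^ m + lam * ((1 + (lam / m) ^ 2) ^ m - 1) ≤ 2 := by
    nlinarith
  have hZ := mul_le_mul_of_nonneg_left hY (show 0 ≤ M by linarith)
  linarith

end Paper
end

section
/- There is an absolute constant C > 0 such that the following holds. Let G be a finite abelian group, A ⊆ G, B a Bohr system on G, μ a B-approximately invariant probability measure, g : G → ℂ, and let p ∈ [2,∞) and ε ∈ (0,1] be parameters. Then there is a Bohr system B' ≤ B with C^Δ(A;B'₁) ≤ (2·ε⁻¹)^{C·p·ε⁻²}·C^Δ(A;B₁) and dim B' ≤ dim B + C·p·ε⁻², such that ‖τ_x(g) − g‖_{L_p(μ)} ≤ ε·‖g‖_{A(G)} for all x ∈ B'₁. -/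
open scoped BigOperators Pointwise ENNReal ENat
open Real

namespace Paper

theorem mgf_bound {ι : Type} [Fintype ι] (w Y : ι → ℝ) (hw : ∀ i, 0 ≤ w i) (hw1 : ∑ i, w i = 1)
    (hY : ∀ i, |Y i| ≤ 2) (h0 : ∑ i, w i * Y i = 0) (t : ℝ) :
    ∑ i, w i * Real.exp (t * Y i) ≤ Real.exp (2 * t ^ 2) := by
  have h1 : ∀ i, w i * Real.exp (t * Y i) ≤
      w i * Real.cosh (2 * t) + (Real.sinh (2 * t) / 2) * (w i * Y i) := by
    intro i
    have h2 : |Y i / 2| ≤ 1 := by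
      rw [abs_div, abs_two]; linarith [hY i]
    have h3 := Real.exp_mul_le_cosh_add_mul_sinh h2 (2 * t)
    have h4 : Y i / 2 * (2 * t) = t * Y i := by ring
    rw [h4] at h3
    have := mul_le_mul_of_nonneg_left h3 (hw i)
    linarith
  calc ∑ i, w i * Real.exp (t * Y i) ≤ ∑ i, (w i * Real.cosh (2 * t) +
        (Real.sinh (2 * t) / 2) * (w i * Y i)) := Finset.sum_le_sum (fun i _ => h1 i)
    _ = Real.cosh (2 * t) := by
        rw [Finset.sum_add_distrib, ← Finset.sum_mul, ← Finset.mul_sum, hw1, h0]; ring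
    _ ≤ Real.exp ((2 * t) ^ 2 / 2) := Real.cosh_le_exp_half_sq _
    _ = _ := by congr 1; ring

theorem exists_sample {ι J : Type} [Fintype ι] [Fintype J] (w : ι → ℝ) (Y : ι → J → ℝ)
    (ν : J → ℝ) (hν : ∀ j, 0 ≤ ν j) (hw : ∀ i, 0 ≤ w i) (hw1 : ∑ i, w i = 1)
    (hY : ∀ i j, |Y i j| ≤ 2) (h0 : ∀ j, ∑ i, w i * Y i j = 0) (t : ℝ) (k : ℕ) :
    ∃ a : Fin k → ι, ∑ j, ν j * Real.exp (t * ∑ i, Y (a i) j) ≤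
      (∑ j, ν j) * Real.exp (2 * t ^ 2 * k) := by
  set R := (∑ j, ν j) * Real.exp (2 * t ^ 2 * k) with hR
  have hW : ∑ a : Fin k → ι, ∏ i, w (a i) = 1 := by
    rw [← Fintype.sum_pow, hw1, one_pow]
  have hE : ∑ a : Fin k → ι, (∏ i, w (a i)) * ∑ j, ν j * Real.exp (t * ∑ i, Y (a i) j) ≤ R := by
    have : ∑ a : Fin k → ι, (∏ i, w (a i)) * ∑ j, ν j * Real.exp (t * ∑ i, Y (a i) j)
        = ∑ j, ν j * (∑ i, w i * Real.exp (t * Y i j)) ^ k := by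
      simp_rw [Fintype.sum_pow, Finset.mul_sum]
      rw [Finset.sum_comm]
      refine Finset.sum_congr rfl fun j _ => Finset.sum_congr rfl fun a _ => ?_
      rw [Finset.prod_mul_distrib, Real.exp_sum]
      ring
    rw [this, hR, Finset.sum_mul]
    refine Finset.sum_le_sum fun j _ => mul_le_mul_of_nonneg_left ?_ (hν j)
    have h1 := mgf_bound w (fun i => Y i j) hw hw1 (fun i => hY i j) (h0 j) t
    have h2 : Real.exp (2 * t ^ 2 * k) = Real.exp (2 * t ^ 2) ^ k := by
      rw [← Real.exp_nat_mul]; congr 1; ring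
    rw [h2]
    exact pow_le_pow_left₀ (Finset.sum_nonneg fun i _ => mul_nonneg (hw i) (Real.exp_pos _).le) h1 k
  by_contra hcon
  push Not at hcon
  have h3 : ∑ a : Fin k → ι, (∏ i, w (a i)) *
      (∑ j, ν j * Real.exp (t * ∑ i, Y (a i) j) - R) ≤ 0 := by
    simp_rw [mul_sub]
    rw [Finset.sum_sub_distrib, ← Finset.sum_mul, hW]
    linarith
  have hWn : ∀ a : Fin k → ι, 0 ≤ ∏ i, w (a i) := fun a => Finset.prod_nonneg fun i _ => hw _
  have h4 : ∀ a ∈ (Finset.univ : Finset (Fin k → ι)), 0 ≤ (∏ i, w (a i)) *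
      (∑ j, ν j * Real.exp (t * ∑ i, Y (a i) j) - R) := fun a _ =>
    mul_nonneg (hWn a) (by linarith [hcon a])
  have h5 := (Finset.sum_eq_zero_iff_of_nonneg h4).1 (le_antisymm h3 (Finset.sum_nonneg h4))
  have h6 : ∑ a : Fin k → ι, ∏ i, w (a i) = 0 := by
    refine Finset.sum_eq_zero fun a ha => ?_
    rcases mul_eq_zero.1 (h5 a ha) with h | h
    · exact h
    · linarith [hcon a]
  linarith

/-- The four real directions of a complex number. -/
noncomputable def dirPart (z : ℂ) : Fin 4 → ℝ := ![z.re, -z.re, z.im, -z.im]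

theorem dirPart_abs_le (z : ℂ) (s : Fin 4) : |dirPart z s| ≤ ‖z‖ := by
  fin_cases s <;> simp [dirPart, Complex.abs_re_le_norm, Complex.abs_im_le_norm]

theorem dirPart_add (z z' : ℂ) (s : Fin 4) : dirPart (z + z') s = dirPart z s + dirPart z' s := by
  fin_cases s <;> simp [dirPart] <;> ring

theorem dirPart_smul (c : ℝ) (z : ℂ) (s : Fin 4) : dirPart (c * z) s = c * dirPart z s := by
  fin_cases s <;> simp [dirPart]

theorem dirPart_zero (s : Fin 4) : dirPart 0 s = 0 := by
  fin_cases s <;> simp [dirPart]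

theorem dirPart_sum {ι : Type} (u : Finset ι) (z : ι → ℂ) (s : Fin 4) :
    dirPart (∑ i ∈ u, z i) s = ∑ i ∈ u, dirPart (z i) s := by
  classical
  induction u using Finset.induction_on with
  | empty => simp [dirPart_zero]
  | insert a u ha ih => rw [Finset.sum_insert ha, Finset.sum_insert ha, dirPart_add, ih]

theorem exists_dirPart (z : ℂ) : ∃ s, ‖z‖ ≤ 2 * dirPart z s := by
  have h := Complex.norm_le_abs_re_add_abs_im z
  rcases le_total |z.re| |z.im| with h1 | h1
  · rcases abs_cases z.im with ⟨h2, _⟩ | ⟨h2, _⟩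
    · exact ⟨2, by simp [dirPart]; linarith⟩
    · exact ⟨3, by simp [dirPart]; linarith⟩
  · rcases abs_cases z.re with ⟨h2, _⟩ | ⟨h2, _⟩
    · exact ⟨0, by simp [dirPart]; linarith⟩
    · exact ⟨1, by simp [dirPart]; linarith⟩

theorem rpow_le_exp_dir (z : ℂ) (p t : ℝ) (hp : 2 ≤ p) (ht : 0 < t) :
    ‖z‖ ^ p ≤ (2 * p / t) ^ p * ∑ s, Real.exp (t * dirPart z s) := by
  obtain ⟨s, hs⟩ := exists_dirPart z
  have hp0 : 0 < p := by linarith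
  have h1 : Real.exp (t * dirPart z s) ≤ ∑ s, Real.exp (t * dirPart z s) :=
    Finset.single_le_sum (f := fun s => Real.exp (t * dirPart z s))
      (fun _ _ => (Real.exp_pos _).le) (Finset.mem_univ s)
  have h2 : ‖z‖ ≤ (2 * p / t) * Real.exp (t * dirPart z s / p) := by
    have h3 : t * dirPart z s / p ≤ Real.exp (t * dirPart z s / p) := by
      linarith [Real.add_one_le_exp (t * dirPart z s / p)]
    calc ‖z‖ ≤ 2 * dirPart z s := hs
      _ = (2 * p / t) * (t * dirPart z s / p) := by field_simp
      _ ≤ _ := mul_le_mul_of_nonneg_left h3 (by positivity)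
  calc ‖z‖ ^ p ≤ ((2 * p / t) * Real.exp (t * dirPart z s / p)) ^ p :=
        Real.rpow_le_rpow (norm_nonneg _) h2 hp0.le
    _ = (2 * p / t) ^ p * Real.exp (t * dirPart z s) := by
        rw [Real.mul_rpow (by positivity) (Real.exp_pos _).le, ← Real.exp_mul]
        congr 2; field_simp
    _ ≤ _ := mul_le_mul_of_nonneg_left h1 (by positivity)

theorem exists_sample_Lp {ι G : Type} [Fintype ι] [Fintype G] (w : ι → ℝ) (X : ι → G → ℂ)
    (m : G → ℂ) (ν : G → ℝ) (hν : ∀ j, 0 ≤ ν j) (hν2 : ∑ j, ν j = 2)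
    (hw : ∀ i, 0 ≤ w i) (hw1 : ∑ i, w i = 1)
    (hX : ∀ i y, ‖X i y‖ ≤ 1) (hm : ∀ y, ∑ i, (w i : ℂ) * X i y = m y)
    (p t : ℝ) (hp : 2 ≤ p) (ht : 0 < t) (k : ℕ) :
    ∃ a : Fin k → ι, ∑ y, ν y * ‖∑ i, (X (a i) y - m y)‖ ^ p ≤
      (2 * p / t) ^ p * (8 * Real.exp (2 * t ^ 2 * k)) := by
  have hm1 : ∀ y, ‖m y‖ ≤ 1 := by
    intro y
    rw [← hm y, ← hw1]
    refine (norm_sum_le _ _).trans (Finset.sum_le_sum fun i _ => ?_)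
    rw [norm_mul, Complex.norm_real, Real.norm_of_nonneg (hw i)]
    exact mul_le_of_le_one_right (hw i) (hX i y)
  obtain ⟨a, ha⟩ := exists_sample (J := G × Fin 4) w
    (fun i j => dirPart (X i j.1 - m j.1) j.2) (fun j => ν j.1) (fun j => hν _) hw hw1
    (fun i j => (dirPart_abs_le _ _).trans ((norm_sub_le _ _).trans
      (by linarith [hX i j.1, hm1 j.1])))
    (fun j => by
      simp_rw [← dirPart_smul]
      rw [← dirPart_sum]
      simp_rw [mul_sub]
      rw [Finset.sum_sub_distrib, hm, ← Finset.sum_mul, ← Complex.ofReal_sum, hw1]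
      simp [dirPart_zero]) t k
  refine ⟨a, ?_⟩
  have e1 : ∑ j : G × Fin 4, ν j.1 = 8 := by
    rw [Fintype.sum_prod_type]
    simp only [Finset.sum_const, Finset.card_univ, Fintype.card_fin, nsmul_eq_mul]
    rw [← Finset.mul_sum, hν2]; norm_num
  rw [e1, Fintype.sum_prod_type] at ha
  have hp0 : 0 < p := by linarith
  refine le_trans ?_ (mul_le_mul_of_nonneg_left ha (by positivity))
  rw [Finset.mul_sum]
  refine Finset.sum_le_sum fun y _ => ?_
  have := mul_le_mul_of_nonneg_left
    (rpow_le_exp_dir (∑ i, (X (a i) y - m y)) p t hp ht) (hν y)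
  refine this.trans (le_of_eq ?_)
  simp only [dirPart_sum]
  rw [← Finset.mul_sum]
  ring

theorem fourier_inversion {G : Type} [AddCommGroup G] [Fintype G] (g : G → ℂ) (y : G) :
    ∑ γ : AddChar G ℂ, fourierCoeff g γ * γ y = g y := by
  classical
  unfold fourierCoeff
  simp_rw [mul_assoc, Finset.sum_mul]
  rw [← Finset.mul_sum, Finset.sum_comm]
  have : ∀ x, ∑ γ : AddChar G ℂ, g x * (starRingEnd ℂ) (γ x) * γ y
      = if y = x then g x * (Fintype.card G : ℂ) else 0 := by
    intro x
    have h1 : ∀ γ : AddChar G ℂ, g x * (starRingEnd ℂ) (γ x) * γ y = g x * γ (y - x) := by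
      intro γ
      rw [sub_eq_add_neg, AddChar.map_add_eq_mul, AddChar.map_neg_eq_conj]; ring
    simp_rw [h1]
    rw [← Finset.mul_sum, AddChar.sum_apply_eq_ite]
    simp [sub_eq_zero]
  simp_rw [this]
  rw [Finset.sum_ite_eq]
  simp
  field_simp

theorem exists_char_sample {G : Type} [AddCommGroup G] [Fintype G] (g : G → ℂ) (ν : G → ℝ)
    (hν : ∀ j, 0 ≤ ν j) (hν2 : ∑ j, ν j = 2) (hM : 0 < wienerNorm g)
    (p ε : ℝ) (hp : 2 ≤ p) (hε : 0 < ε) (hε1 : ε ≤ 1) :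
    ∃ (k : ℕ) (a : Fin k → AddChar G ℂ) (c : Fin k → ℂ), (k : ℝ) ≤ 79001 * p * ε⁻¹ ^ 2 ∧ 
      0 < k ∧ (∀ i, ‖c i‖ ≤ 1) ∧
      ∑ y, ν y * ‖g y - (wienerNorm g / k : ℝ) * ∑ i, c i * a i y‖ ^ p ≤
        (ε * wienerNorm g / 9) ^ p := by
  have hp0 : 0 < p := by linarith
  set M := wienerNorm g with hMdef
  have hMs : M = ∑ γ : AddChar G ℂ, ‖fourierCoeff g γ‖ := by
    rw [hMdef, wienerNorm, finsum_eq_sum_of_fintype]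
  choose c hc1 hc2 using fun γ : AddChar G ℂ => Complex.exists_norm_mul_eq_self (fourierCoeff g γ)
  set k : ℕ := ⌈79000 * p * ε⁻¹ ^ 2⌉₊ with hk
  have hq : 1 ≤ ε⁻¹ ^ 2 := one_le_pow₀ ((one_le_inv₀ hε).2 hε1)
  have hk1 : 79000 * p * ε⁻¹ ^ 2 ≤ k := Nat.le_ceil _
  have hk2 : (k : ℝ) ≤ 79000 * p * ε⁻¹ ^ 2 + 1 := (Nat.ceil_lt_add_one (by positivity)).le
  have hkpos : 0 < (k : ℝ) := lt_of_lt_of_le (by positivity) hk1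
  have hpq : 1 ≤ p * ε⁻¹ ^ 2 := by nlinarith
  obtain ⟨a, ha⟩ := exists_sample_Lp (fun γ : AddChar G ℂ => ‖fourierCoeff g γ‖ / M)
    (fun γ y => c γ * γ y) (fun y => g y / M) ν hν hν2 (fun γ => by positivity)
    (by rw [← Finset.sum_div, ← hMs, div_self hM.ne'])
    (fun γ y => by rw [norm_mul, hc1, AddChar.norm_apply, one_mul])
    (fun y => by
      rw [← fourier_inversion g y, Finset.sum_div]
      refine Finset.sum_congr rfl fun γ _ => ?_
      conv_rhs => rw [← hc2 γ]
      push_cast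
      ring) p (ε / 400) hp (by positivity) k
  refine ⟨k, a, fun i => c (a i), by linarith, by exact_mod_cast hkpos, fun i => (hc1 _).le, ?_⟩
  have e1 : ∀ y, ‖g y - (M / k : ℝ) * ∑ i, c (a i) * a i y‖ ^ p =
      (M / k) ^ p * ‖∑ i, (c (a i) * a i y - g y / M)‖ ^ p := by
    intro y
    rw [← Real.mul_rpow (by positivity) (norm_nonneg _)]
    congr 1
    have : g y - (M / k : ℝ) * ∑ i, c (a i) * a i y =
        -((M / k : ℝ) * ∑ i, (c (a i) * a i y - g y / M)) := by
      rw [Finset.sum_sub_distrib]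
      simp only [Finset.sum_const, Finset.card_univ, Fintype.card_fin, nsmul_eq_mul]
      have hk' : (k : ℂ) ≠ 0 := by exact_mod_cast hkpos.ne'
      have hM' : (M : ℂ) ≠ 0 := by exact_mod_cast hM.ne'
      push_cast
      field_simp
      ring
    rw [this, norm_neg, norm_mul, Complex.norm_real, Real.norm_of_nonneg (by positivity)]
  simp_rw [e1]
  have e2 : ∑ y, ν y * ((M / k) ^ p * ‖∑ i, (c (a i) * a i y - g y / M)‖ ^ p) =
      (M / k) ^ p * ∑ y, ν y * ‖∑ i, (c (a i) * a i y - g y / M)‖ ^ p := by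
    rw [Finset.mul_sum]; exact Finset.sum_congr rfl fun y _ => by ring
  rw [e2]
  refine (mul_le_mul_of_nonneg_left ha (by positivity)).trans ?_
  have h8 : (8 : ℝ) ≤ 3 ^ p := by
    calc (8 : ℝ) ≤ 3 ^ (2 : ℝ) := by norm_num
      _ ≤ 3 ^ p := Real.rpow_le_rpow_of_exponent_le (by norm_num) hp
  have hex : Real.exp (2 * (ε / 400) ^ 2 * k) ≤ Real.exp 1 ^ p := by
    rw [← Real.exp_mul, Real.exp_le_exp, one_mul]
    have : ε ^ 2 * k ≤ 79000 * p + 1 := by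
      calc ε ^ 2 * k ≤ ε ^ 2 * (79000 * p * ε⁻¹ ^ 2 + 1) :=
            mul_le_mul_of_nonneg_left hk2 (by positivity)
        _ = 79000 * p + ε ^ 2 := by field_simp
        _ ≤ _ := by nlinarith
    nlinarith
  calc (M / k) ^ p * ((2 * p / (ε / 400)) ^ p * (8 * Real.exp (2 * (ε / 400) ^ 2 * k)))
      ≤ (M / k) ^ p * ((2 * p / (ε / 400)) ^ p * (3 ^ p * Real.exp 1 ^ p)) := by gcongr
    _ = ((M / k) * ((2 * p / (ε / 400)) * (3 * Real.exp 1))) ^ p := by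
        rw [Real.mul_rpow, Real.mul_rpow, Real.mul_rpow] <;> positivity
    _ ≤ _ := by
        refine Real.rpow_le_rpow (by positivity) ?_ hp0.le
        have he : Real.exp 1 ≤ 2.72 := by linarith [Real.exp_one_lt_d9]
        have h9 : 2 * p / (ε / 400) * (3 * Real.exp 1) * 9 ≤ ε * k := by
          calc 2 * p / (ε / 400) * (3 * Real.exp 1) * 9
              ≤ 2 * p / (ε / 400) * (3 * 2.72) * 9 := by gcongr
            _ = 58752 * (p * ε⁻¹) := by field_simp; norm_num
            _ ≤ 79000 * (p * ε⁻¹) := by gcongr; norm_num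
            _ = ε * (79000 * p * ε⁻¹ ^ 2) := by field_simp
            _ ≤ _ := by gcongr
        rw [div_mul_eq_mul_div, div_le_div_iff₀ hkpos (by norm_num)]
        nlinarith

theorem dCov_le_card {G H : Type} [AddCommGroup G] [AddCommGroup H] {S T : Set G}
    (φ : G →+ H) (V : Set H) (X : Finset H) (hS : S ⊆ φ ⁻¹' ((X : Set H) + V))
    (hV : φ ⁻¹' (V - V) ⊆ T) : dCoveringNumber S T ≤ X.card := by
  refine iInf_le_of_le H (iInf_le_of_le inferInstance ?_)
  refine iInf_le_of_le φ (iInf_le_of_le ((X : Set H) + V) (iInf_le_of_le V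
    (iInf_le_of_le hS (iInf_le_of_le hV ?_))))
  exact sInf_le ⟨X, rfl, subset_rfl⟩

theorem exists_of_dCov_le {G : Type} [AddCommGroup G] {S T : Set G} {n : ℕ}
    (h : dCoveringNumber S T ≤ n) : ∃ (H : Type) (_ : AddCommGroup H) (φ : G →+ H) (V : Set H)
      (X : Finset H), S ⊆ φ ⁻¹' ((X : Set H) + V) ∧ φ ⁻¹' (V - V) ⊆ T ∧ X.card ≤ n := by
  have h1 : dCoveringNumber S T < ((n + 1 : ℕ) : ℕ∞) :=
    lt_of_le_of_lt h (by exact_mod_cast Nat.lt_succ_self n)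
  unfold dCoveringNumber dCovAux at h1
  simp only [iInf_lt_iff] at h1
  obtain ⟨H, inst, φ, U, V, hS, hV, hc⟩ := h1
  unfold coveringNumber at hc
  rw [sInf_lt_iff] at hc
  obtain ⟨m, ⟨X, hX, hU⟩, hm⟩ := hc
  refine ⟨H, inst, φ, V, X, fun x hx => hU (hS hx), hV, ?_⟩
  rw [← hX] at hm
  have : X.card < n + 1 := by exact_mod_cast hm
  omega

theorem dCov_le_natCard {G : Type} [AddCommGroup G] [Fintype G] {S T : Set G} (hT : 0 ∈ T) :
    dCoveringNumber S T ≤ Fintype.card G := by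
  refine dCov_le_card (H := G) (AddMonoidHom.id G) {0} Finset.univ ?_ ?_
  · intro x _
    simp
  · intro x hx
    simp at hx
    rw [hx]; exact hT

theorem one_le_dCov {G : Type} [AddCommGroup G] {S T : Set G} (hS : S.Nonempty) :
    1 ≤ dCoveringNumber S T := by
  by_contra hcon
  have h0 : dCoveringNumber S T ≤ (0 : ℕ) := by
    have := Order.lt_one_iff.1 (not_le.1 hcon)
    simp [this]
  obtain ⟨H, _, φ, V, X, h1, h2, h3⟩ := exists_of_dCov_le h0
  obtain ⟨x, hx⟩ := hS
  have := h1 hx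
  have hX : X = ∅ := by simpa using h3
  simp [hX] at this

theorem dCov_inter_le {G : Type} [AddCommGroup G] {S T S' T' : Set G} {n m : ℕ}
    (h : dCoveringNumber S T ≤ n) (h' : dCoveringNumber S' T' ≤ m) :
    dCoveringNumber (S ∩ S') (T ∩ T') ≤ (n * m : ℕ) := by
  obtain ⟨H, _, φ, V, X, h1, h2, h3⟩ := exists_of_dCov_le h
  obtain ⟨H', _, φ', V', X', h1', h2', h3'⟩ := exists_of_dCov_le h'
  refine (dCov_le_card (φ.prod φ') (V ×ˢ V') (X ×ˢ X') ?_ ?_).trans ?_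
  · rintro x ⟨hx, hx'⟩
    obtain ⟨a, ha, b, hb, hab⟩ := h1 hx
    obtain ⟨a', ha', b', hb', hab'⟩ := h1' hx'
    refine ⟨(a, a'), by simpa using ⟨ha, ha'⟩, (b, b'), ⟨hb, hb'⟩, ?_⟩
    simp at hab hab'
    simp [hab, hab']
  · rintro x ⟨⟨a, a'⟩, ⟨ha, ha'⟩, ⟨b, b'⟩, ⟨hb, hb'⟩, hab⟩
    simp at hab
    exact ⟨h2 ⟨a, ha, b, hb, hab.1⟩, h2' ⟨a', ha', b', hb', hab.2⟩⟩
  · rw [Finset.card_product]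
    exact_mod_cast Nat.mul_le_mul h3 h3'

theorem circNorm_exp_le (ψ : ℝ) : circNorm (Complex.exp (2 * Real.pi * ψ * Complex.I)) ≤ |ψ| := by
  unfold circNorm
  rw [div_le_iff₀ (by positivity)]
  have e : (2 * Real.pi * ψ * Complex.I : ℂ) = ((2 * Real.pi * ψ : ℝ) : ℂ) * Complex.I := by
    push_cast; ring
  rw [e]
  have e2 : |ψ| * (2 * Real.pi) = |2 * Real.pi * ψ| := by
    rw [abs_mul, abs_of_pos Real.two_pi_pos]; ring
  rw [e2]
  rcases lt_or_ge Real.pi |2 * Real.pi * ψ| with h | h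
  · exact (Complex.abs_arg_le_pi _).trans h.le
  · rcases eq_or_ne (2 * Real.pi * ψ) (-Real.pi) with h1 | h1
    · refine (Complex.abs_arg_le_pi _).trans ?_
      rw [h1, abs_neg, abs_of_pos Real.pi_pos]
    · rw [Complex.arg_exp_mul_I, (toIocMod_eq_self Real.two_pi_pos).2]
      rw [abs_le] at h
      exact ⟨lt_of_le_of_ne h.1 (Ne.symm h1), by linarith [h.2]⟩

theorem char_eq_exp {G : Type} [AddCommGroup G] [Finite G] (γ : AddChar G ℂ) (x : G) :
    γ x = Complex.exp (2 * Real.pi * ((γ x).arg / (2 * Real.pi) : ℝ) * Complex.I) := by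
  have h := Complex.norm_mul_exp_arg_mul_I (γ x)
  rw [AddChar.norm_apply, Complex.ofReal_one, one_mul] at h
  conv_lhs => rw [← h]
  congr 1
  push_cast
  have : (Real.pi : ℂ) ≠ 0 := by exact_mod_cast Real.pi_ne_zero
  field_simp

theorem dCov_char_le {G : Type} [AddCommGroup G] [Finite G] (γ : AddChar G ℂ) (S : Set G)
    (δ : ℝ) (hδ : 0 < δ) (J : Finset ℤ)
    (hJ : ∀ x ∈ S, ⌊(γ x).arg / (2 * Real.pi) / δ⌋ ∈ J) :
    dCoveringNumber S {x | circNorm (γ x) < δ} ≤ J.card := by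
  classical
  have hne : ∀ x, γ x ≠ 0 := fun x h => by
    have := AddChar.norm_apply γ x
    rw [h] at this; simp at this
  let φ : G →+ Additive ℂˣ := AddMonoidHom.mk' (fun x => Additive.ofMul (Units.mk0 (γ x) (hne x)))
    (fun x y => by
      apply Additive.toMul.injective
      ext
      simp [AddChar.map_add_eq_mul])
  let e : ℝ → Additive ℂˣ := fun θ => Additive.ofMul
    (Units.mk0 (Complex.exp (2 * Real.pi * θ * Complex.I)) (Complex.exp_ne_zero _))
  have hadd : ∀ a b, e (a + b) = e a + e b := by
    intro a b
    apply Additive.toMul.injective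
    ext
    simp only [e, toMul_ofMul, toMul_add, Units.val_mk0, Units.val_mul]
    rw [← Complex.exp_add]
    congr 1
    push_cast; ring
  have hφe : ∀ x θ, φ x = e θ → γ x = Complex.exp (2 * Real.pi * θ * Complex.I) := by
    intro x θ h
    have := congrArg (fun z : Additive ℂˣ => ((Additive.toMul z : ℂˣ) : ℂ)) h
    simpa [φ, e] using this
  have hφ : ∀ x, φ x = e ((γ x).arg / (2 * Real.pi)) := by
    intro x
    apply Additive.toMul.injective
    ext
    exact char_eq_exp γ x
  refine (dCov_le_card φ (e '' Set.Ico 0 δ) (J.image fun j : ℤ => e ((j : ℝ) * δ)) ?_ ?_).trans ?_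
  · intro x hx
    set θ := (γ x).arg / (2 * Real.pi) with hθ
    have hj := hJ x hx
    refine ⟨e (⌊θ / δ⌋ * δ), ?_, e (θ - ⌊θ / δ⌋ * δ), ⟨_, ⟨?_, ?_⟩, rfl⟩, ?_⟩
    · rw [Finset.coe_image]
      exact ⟨_, hj, rfl⟩
    · have := Int.floor_le (θ / δ)
      rw [le_div_iff₀ hδ] at this
      linarith
    · have := Int.lt_floor_add_one (θ / δ)
      rw [div_lt_iff₀ hδ] at this
      linarith
    · change e _ + e _ = φ x
      rw [← hadd, hφ]
      congr 1
      ring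
  · rintro x ⟨_, ⟨a, ha, rfl⟩, _, ⟨b, hb, rfl⟩, hab⟩
    have h1 : φ x = e (a - b) := by
      have h2 := hadd (a - b) b
      rw [sub_add_cancel] at h2
      change e a - e b = φ x at hab
      rw [← hab, h2, add_sub_cancel_right]
    have h3 := hφe x _ h1
    change circNorm (γ x) < δ
    rw [h3]
    refine (circNorm_exp_le _).trans_lt ?_
    rw [abs_lt]
    exact ⟨by linarith [ha.1, hb.2], by linarith [ha.2, hb.1]⟩
  · exact_mod_cast Finset.card_image_le

theorem BohrSystem.zero_mem {G : Type} [AddCommGroup G] (B : BohrSystem G) {η : ℝ} (h0 : 0 < η)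
    (h1 : η ≤ 1) : 0 ∈ B.sets η := by
  obtain ⟨Γ, δ, hδ, h⟩ := B.exists_gen
  rw [h η h0 h1]
  intro γ hγ
  have := hδ γ hγ
  simp [circNorm]
  positivity

theorem circNorm_neg {G : Type} [AddCommGroup G] (γ : AddChar G ℂ) (x : G) :
    circNorm (γ (-x)) = circNorm (γ x) := by
  unfold circNorm
  rw [AddChar.map_neg_eq_inv, Complex.abs_arg_inv]

theorem BohrSystem.neg_mem {G : Type} [AddCommGroup G] (B : BohrSystem G) {η : ℝ} (h0 : 0 < η)
    (h1 : η ≤ 1) {x : G} (hx : x ∈ B.sets η) : -x ∈ B.sets η := by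
  obtain ⟨Γ, δ, hδ, h⟩ := B.exists_gen
  rw [h η h0 h1] at hx ⊢
  intro γ hγ
  rw [circNorm_neg]
  exact hx γ hγ

/-- Add one character to a Bohr system. -/
def BohrSystem.addChar {G : Type} [AddCommGroup G] (B : BohrSystem G) (γ : AddChar G ℂ) (r : ℝ)
    (hr : 0 < r) : BohrSystem G where
  sets := fun η => B.sets η ∩ {x | circNorm (γ x) < η * r}
  exists_gen := by
    classical
    obtain ⟨Γ, δ, hδ, h⟩ := B.exists_gen
    refine ⟨insert γ Γ, fun χ => if χ = γ then (if γ ∈ Γ then min r (δ γ) else r) else δ χ,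
      ?_, ?_⟩
    · intro χ hχ
      by_cases h1 : χ = γ
      · by_cases h2 : γ ∈ Γ
        · simp [h1, h2, hr, hδ γ h2]
        · simp [h1, h2, hr]
      · have h3 : χ ∈ Γ := by
          rcases hχ with h4 | h4
          · exact absurd h4 h1
          · exact h4
        simp [h1, hδ χ h3]
    · intro η h0 h1
      change B.sets η ∩ {x | circNorm (γ x) < η * r} = _
      rw [h η h0 h1]
      ext x
      constructor
      · rintro ⟨hx, hx'⟩ χ hχ
        by_cases h2 : χ = γ
        · subst h2
          by_cases h3 : χ ∈ Γ
          · simp only [h3, if_true]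
            rw [mul_min_of_nonneg _ _ h0.le]
            exact lt_min hx' (hx χ h3)
          · simpa [h3] using hx'
        · have h3 : χ ∈ Γ := by
            rcases hχ with h4 | h4
            · exact absurd h4 h2
            · exact h4
          simpa [h2] using hx χ h3
      · intro hx
        constructor
        · intro χ hχ
          have h3 := hx χ (Set.mem_insert_of_mem _ hχ)
          by_cases h2 : χ = γ
          · subst h2
            simp only [hχ, if_true] at h3
            rw [mul_min_of_nonneg _ _ h0.le] at h3
            exact (lt_min_iff.1 h3).2
          · simpa [h2] using h3
        · have h3 := hx γ (Set.mem_insert _ _)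
          by_cases h2 : γ ∈ Γ
          · simp only [h2, if_true] at h3
            rw [mul_min_of_nonneg _ _ h0.le] at h3
            exact (lt_min_iff.1 h3).1
          · simpa [h2] using h3

theorem dim_addChar_le {G : Type} [AddCommGroup G] [Fintype G] (B : BohrSystem G)
    (γ : AddChar G ℂ) (r : ℝ) (hr : 0 < r) : (B.addChar γ r hr).dim ≤ B.dim + 2 := by
  unfold BohrSystem.dim dimOfSets
  refine csSup_le ⟨_, 1, one_pos, le_rfl, rfl⟩ ?_
  rintro _ ⟨η, h0, h1, rfl⟩
  have hη2 : 0 < η / 2 := by positivity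
  have hfin : ∀ (B : BohrSystem G) (η : ℝ), 0 < η → η ≤ 1 → ∃ n : ℕ,
      dCoveringNumber (B.sets η) (B.sets (η / 2)) = n ∧ 1 ≤ n ∧ n ≤ Fintype.card G := by
    intro B η h0 h1
    have h2 : dCoveringNumber (B.sets η) (B.sets (η / 2)) ≤ Fintype.card G :=
      dCov_le_natCard (B.zero_mem (by linarith) (by linarith))
    obtain ⟨n, hn⟩ := ENat.ne_top_iff_exists.1 (ne_top_of_le_ne_top (ENat.natCast_ne_top _) h2)
    have h3 : 1 ≤ dCoveringNumber (B.sets η) (B.sets (η / 2)) := one_le_dCov ⟨0, B.zero_mem h0 h1⟩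
    rw [← hn] at h2 h3
    exact ⟨n, hn.symm, by exact_mod_cast h3, by exact_mod_cast h2⟩
  obtain ⟨n, hn, hn1, -⟩ := hfin B η h0 h1
  obtain ⟨m, hm, hm1, -⟩ := hfin (B.addChar γ r hr) η h0 h1
  have hle : m ≤ n * 4 := by
    have h2 := dCov_char_le γ {x | circNorm (γ x) < η * r} (η / 2 * r) (by positivity)
      (Finset.Icc (-2) 1) (by
        intro x hx
        change |(γ x).arg| / (2 * Real.pi) < η * r at hx
        set θ := (γ x).arg / (2 * Real.pi) with hθ
        have h3 : |θ| < η * r := by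
          rwa [hθ, abs_div, abs_of_pos Real.two_pi_pos]
        rw [abs_lt] at h3
        have hpos : 0 < η / 2 * r := by positivity
        rw [Finset.mem_Icc]
        constructor
        · rw [Int.le_floor, le_div_iff₀ hpos]; push_cast; linarith
        · rw [← Int.lt_add_one_iff, Int.floor_lt, div_lt_iff₀ hpos]; push_cast; linarith)
    have h4 := dCov_inter_le hn.le h2
    have h5 : (m : ℕ∞) ≤ ((n * (Finset.Icc (-2 : ℤ) 1).card : ℕ) : ℕ∞) := hm.symm.le.trans h4
    exact_mod_cast h5
  have hbdd : BddAbove {s : ℝ | ∃ η : ℝ, 0 < η ∧ η ≤ 1 ∧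
      s = Real.logb 2 (enatReal (dCoveringNumber (B.sets η) (B.sets (η / 2))))} := by
    refine ⟨Real.logb 2 (Fintype.card G), ?_⟩
    rintro _ ⟨η, h0, h1, rfl⟩
    obtain ⟨n, hn, hn1, hn2⟩ := hfin B η h0 h1
    rw [hn]
    simp only [enatReal, ENat.toNat_natCast]
    exact Real.logb_le_logb_of_le (by norm_num) (by exact_mod_cast hn1) (by exact_mod_cast hn2)
  have h6 := le_csSup hbdd ⟨η, h0, h1, rfl⟩
  refine le_trans ?_ (add_le_add_left h6 2)
  rw [hn, hm]
  simp only [enatReal, ENat.toNat_natCast]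
  have hn0 : (n : ℝ) ≠ 0 := by positivity
  have : Real.logb 2 (n * 4 : ℝ) = Real.logb 2 n + 2 := by
    rw [Real.logb_mul hn0 (by norm_num)]
    congr 1
    rw [Real.logb_eq_iff_rpow_eq] <;> norm_num
  rw [← this]
  exact Real.logb_le_logb_of_le (by norm_num) (by exact_mod_cast hm1) (by exact_mod_cast hle)

theorem cov_addChar_le {G : Type} [AddCommGroup G] [Fintype G] (A : Set G) (B : BohrSystem G)
    (γ : AddChar G ℂ) (ε : ℝ) (hε : 0 < ε) (hε1 : ε ≤ 1) (hr : 0 < ε / 64) :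
    (dCoveringNumber A ((B.addChar γ (ε / 64) hr).sets 1) : ℝ≥0∞) ≤
      ENNReal.ofReal ((2 * ε⁻¹) ^ (7 : ℕ)) * (dCoveringNumber A (B.sets 1) : ℝ≥0∞) := by
  have h2 : dCoveringNumber A (B.sets 1) ≤ Fintype.card G :=
    dCov_le_natCard (B.zero_mem one_pos le_rfl)
  obtain ⟨n, hn⟩ := ENat.ne_top_iff_exists.1 (ne_top_of_le_ne_top (ENat.natCast_ne_top _) h2)
  set N : ℕ := ⌈32 / ε⌉₊ with hN
  have hN1 : 32 / ε ≤ N := Nat.le_ceil _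
  have hN2 : (N : ℝ) ≤ 32 / ε + 1 := (Nat.ceil_lt_add_one (by positivity)).le
  have h3 := dCov_char_le γ Set.univ (ε / 64) hr (Finset.Icc (-(N : ℤ)) N) (by
    intro x _
    set θ := (γ x).arg / (2 * Real.pi) with hθ
    have h3 : |θ| ≤ 1 / 2 := by
      rw [hθ, abs_div, abs_of_pos Real.two_pi_pos, div_le_iff₀ Real.two_pi_pos]
      linarith [Complex.abs_arg_le_pi (γ x)]
    have h4 : |θ / (ε / 64)| ≤ N := by
      rw [abs_div, abs_of_pos hr]
      refine le_trans ?_ hN1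
      rw [div_le_iff₀ hr]
      have : 32 / ε * (ε / 64) = 1 / 2 := by field_simp; norm_num
      rw [this]; exact h3
    rw [abs_le] at h4
    rw [Finset.mem_Icc]
    constructor
    · rw [Int.le_floor]; push_cast; exact h4.1
    · have := (Int.floor_le _).trans h4.2
      exact_mod_cast this)
  have h4 := dCov_inter_le hn.symm.le h3
  rw [Set.inter_univ] at h4
  have h5 : (B.addChar γ (ε / 64) hr).sets 1 = B.sets 1 ∩ {x | circNorm (γ x) < ε / 64} := by
    simp [BohrSystem.addChar]
  rw [h5]
  have h6 := ENat.toENNReal_le.2 h4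
  refine h6.trans ?_
  rw [← hn]
  have hc : (Finset.Icc (-(N : ℤ)) N).card = 2 * N + 1 := by
    rw [Int.card_Icc]; omega
  rw [hc]
  have h7 : ((2 * N + 1 : ℕ) : ℝ) ≤ (2 * ε⁻¹) ^ 7 := by
    have hq : 1 ≤ ε⁻¹ := (one_le_inv₀ hε).2 hε1
    push_cast
    calc (2 * N + 1 : ℝ) ≤ 2 * (32 / ε + 1) + 1 := by linarith
      _ = 64 * ε⁻¹ + 3 := by rw [div_eq_mul_inv]; ring
      _ ≤ 128 * ε⁻¹ := by linarith
      _ ≤ 128 * ε⁻¹ ^ 7 := by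
          gcongr
          exact le_self_pow₀ hq (by norm_num)
      _ = _ := by rw [mul_pow]; norm_num
  have h8 : ((2 * N + 1 : ℕ) : ℝ≥0∞) ≤ ENNReal.ofReal ((2 * ε⁻¹) ^ 7) := by
    rw [← ENNReal.ofReal_natCast]
    exact ENNReal.ofReal_le_ofReal h7
  have h9 : (((n * (2 * N + 1) : ℕ) : ℕ∞) : ℝ≥0∞) = ((2 * N + 1 : ℕ) : ℝ≥0∞) * (n : ℝ≥0∞) := by
    rw [ENat.toENNReal_coe]; push_cast; ring
  rw [h9, ENat.toENNReal_coe]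
  gcongr

theorem exists_addChars {G : Type} [AddCommGroup G] [Fintype G] (A : Set G) (B : BohrSystem G)
    (ε : ℝ) (hε : 0 < ε) (hε1 : ε ≤ 1) (k : ℕ) (a : Fin k → AddChar G ℂ) :
    ∃ B' : BohrSystem G, B'.le B ∧
      (dCoveringNumber A (B'.sets 1) : ℝ≥0∞) ≤
        ENNReal.ofReal ((2 * ε⁻¹) ^ (7 : ℕ)) ^ k * (dCoveringNumber A (B.sets 1) : ℝ≥0∞) ∧
      B'.dim ≤ B.dim + 2 * k ∧
      ∀ x ∈ B'.sets 1, ∀ i, circNorm (a i x) < ε / 64 := by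
  induction k with
  | zero => exact ⟨B, fun η _ _ => subset_rfl, by simp, by simp, fun x _ i => i.elim0⟩
  | succ k ih =>
    obtain ⟨B₁, h1, h2, h3, h4⟩ := ih (fun i => a i.castSucc)
    have hr : 0 < ε / 64 := by positivity
    refine ⟨B₁.addChar (a (Fin.last k)) (ε / 64) hr, ?_, ?_, ?_, ?_⟩
    · intro η h0 h1'
      exact Set.inter_subset_left.trans (h1 η h0 h1')
    · refine (cov_addChar_le A B₁ (a (Fin.last k)) ε hε hε1 hr).trans ?_
      refine (mul_le_mul_right h2 _).trans (le_of_eq ?_)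
      rw [pow_succ' (ENNReal.ofReal _) k, mul_assoc]
    · have := dim_addChar_le B₁ (a (Fin.last k)) (ε / 64) hr
      push_cast
      linarith
    · rintro x ⟨hx, hx'⟩ i
      refine Fin.lastCases ?_ (fun j => h4 x hx j) i
      simpa using hx'

/-- Lemma 6.3, an `L_p` almost-periodicity result à la Croot–Łaba–Sisask. -/
theorem statement12 :
    ∃ C : ℝ, 0 < C ∧
      ∀ (G : Type) [AddCommGroup G] [Fintype G],
        ∀ (A : Set G) (B : BohrSystem G) (μ : G → ℝ) (g : G → ℂ) (p ε : ℝ),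
          IsProb μ → ApproxInvariant B.sets μ → 2 ≤ p → 0 < ε → ε ≤ 1 →
          ∃ B' : BohrSystem G, B'.le B ∧
            ((dCoveringNumber A (B'.sets 1) : ℝ≥0∞) ≤
              ENNReal.ofReal ((2 * ε⁻¹) ^ (C * p * ε⁻¹ ^ 2)) *
                (dCoveringNumber A (B.sets 1) : ℝ≥0∞)) ∧
            B'.dim ≤ B.dim + C * p * ε⁻¹ ^ 2 ∧
            ∀ x ∈ B'.sets 1, LpW p μ (fun y => g (y - x) - g y) ≤ ε * wienerNorm g := by
  refine ⟨7 * 79001, by norm_num, ?_⟩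
  intro G _ _ A B μ g p ε hμ hinv hp hε hε1
  have hp0 : 0 < p := by linarith
  have hq : 1 ≤ ε⁻¹ := (one_le_inv₀ hε).2 hε1
  have hMs : wienerNorm g = ∑ γ : AddChar G ℂ, ‖fourierCoeff g γ‖ := by
    rw [wienerNorm, finsum_eq_sum_of_fintype]
  have hM0 : 0 ≤ wienerNorm g := by rw [hMs]; positivity
  rcases hM0.eq_or_lt with hM | hM
  · -- the trivial case
    have hg : ∀ y, g y = 0 := by
      intro y
      rw [← fourier_inversion g y]
      refine Finset.sum_eq_zero fun γ _ => ?_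
      have := (Finset.sum_eq_zero_iff_of_nonneg (fun γ _ => norm_nonneg _)).1
        (hMs.symm.trans hM.symm) γ (Finset.mem_univ _)
      rw [norm_eq_zero.1 this, zero_mul]
    refine ⟨B, fun η _ _ => subset_rfl, ?_, ?_, ?_⟩
    · refine le_mul_of_one_le_left' ?_
      rw [ENNReal.one_le_ofReal]
      exact Real.one_le_rpow (by linarith) (by positivity)
    · have : 0 ≤ 7 * 79001 * p * ε⁻¹ ^ 2 := by positivity
      linarith
    · intro x _
      rw [← hM]
      simp [LpW, hg, Real.zero_rpow hp0.ne', hp0.ne']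
  · obtain ⟨wp, wm, hwp, -, hw⟩ := hinv 1 one_pos le_rfl
    obtain ⟨k, a, c, hk, hkpos, hc, hS⟩ := exists_char_sample g (fun y => μ y + wp y)
      (fun y => add_nonneg (hμ.1 y) (hwp.1 y))
      (by rw [Finset.sum_add_distrib, hμ.2, hwp.2]; norm_num) hM p ε hp hε hε1
    obtain ⟨B', hB1, hB2, hB3, hB4⟩ := exists_addChars A B ε hε hε1 k a
    have hkp : (0 : ℝ) < k := by exact_mod_cast hkpos
    refine ⟨B', hB1, ?_, ?_, ?_⟩
    · refine hB2.trans ?_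
      refine mul_le_mul_left ?_ _
      rw [← ENNReal.ofReal_pow (by positivity)]
      refine ENNReal.ofReal_le_ofReal ?_
      rw [← pow_mul, ← Real.rpow_natCast]
      refine Real.rpow_le_rpow_of_exponent_le (by linarith) ?_
      push_cast
      linarith
    · refine hB3.trans ?_
      have : 0 ≤ p * ε⁻¹ ^ 2 := by positivity
      linarith
    · intro x hx
      set M := wienerNorm g with hMdef
      set f : G → ℂ := fun y => (M / k : ℝ) * ∑ i, c i * a i y with hf
      set D : G → ℂ := fun y => g y - f y with hD
      set e : ℝ := ε * M / 9 with he
      have hepos : 0 < e := by positivity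
      have hxB : -x ∈ B.sets 1 := B.neg_mem one_pos le_rfl (hB1 1 one_pos le_rfl hx)
      -- the sampled function is almost invariant
      have hfx : ∀ y, ‖f (y - x) - f y‖ ≤ e := by
        intro y
        have h1 : f (y - x) - f y = (M / k : ℝ) * ∑ i, c i * (a i (y - x) * (1 - a i x)) := by
          simp only [hf]
          rw [← mul_sub, ← Finset.sum_sub_distrib]
          congr 1
          refine Finset.sum_congr rfl fun i _ => ?_
          have : a i y = a i (y - x) * a i x := by
            rw [← AddChar.map_add_eq_mul, sub_add_cancel]
          rw [this]; ring
        rw [h1, norm_mul, Complex.norm_real, Real.norm_of_nonneg (by positivity)]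
        have h2 : ∀ i, ‖c i * (a i (y - x) * (1 - a i x))‖ ≤ ε / 9 := by
          intro i
          rw [norm_mul, norm_mul, AddChar.norm_apply, one_mul]
          have h3 : ‖1 - a i x‖ ≤ ε / 9 := by
            have h4 := hB4 x hx i
            unfold circNorm at h4
            rw [div_lt_iff₀ Real.two_pi_pos] at h4
            have h5 := Complex.norm_mul_exp_arg_mul_I (a i x)
            rw [AddChar.norm_apply, Complex.ofReal_one, one_mul, mul_comm] at h5
            rw [norm_sub_rev]
            nth_rewrite 1 [← h5]
            refine Real.norm_exp_I_mul_ofReal_sub_one_le.trans ?_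
            rw [Real.norm_eq_abs]
            have := Real.pi_lt_d2
            nlinarith
          calc ‖c i‖ * ‖1 - a i x‖ ≤ 1 * (ε / 9) :=
                mul_le_mul (hc i) h3 (norm_nonneg _) zero_le_one
            _ = ε / 9 := one_mul _
        have h3 : ‖∑ i, c i * (a i (y - x) * (1 - a i x))‖ ≤ k * (ε / 9) := by
          refine (norm_sum_le_of_le _ (fun i _ => h2 i)).trans (le_of_eq ?_)
          simp
        refine (mul_le_mul_of_nonneg_left h3 (by positivity)).trans (le_of_eq ?_)
        rw [he]; field_simp
      have hpt : ∀ y, ‖g (y - x) - g y‖ ^ p ≤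
          3 ^ p * (‖D (y - x)‖ ^ p + e ^ p + ‖D y‖ ^ p) := by
        intro y
        set m := max (max ‖D (y - x)‖ e) ‖D y‖ with hm
        have h1 : g (y - x) - g y = D (y - x) + (f (y - x) - f y) - D y := by
          simp only [hD]; ring
        have h2 : ‖g (y - x) - g y‖ ≤ 3 * m := by
          rw [h1]
          have i1 : ‖D (y - x)‖ ≤ m := (le_max_left _ _).trans (le_max_left _ _)
          have i2 : e ≤ m := (le_max_right _ _).trans (le_max_left _ _)
          have i3 : ‖D y‖ ≤ m := le_max_right _ _
          have := norm_sub_le (D (y - x) + (f (y - x) - f y)) (D y)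
          have := norm_add_le (D (y - x)) (f (y - x) - f y)
          linarith [hfx y]
        have hm0 : 0 ≤ m := (norm_nonneg _).trans (le_max_right _ _)
        have h3 : m ^ p ≤ ‖D (y - x)‖ ^ p + e ^ p + ‖D y‖ ^ p := by
          have j1 : 0 ≤ ‖D (y - x)‖ ^ p := by positivity
          have j2 : 0 ≤ e ^ p := by positivity
          have j3 : 0 ≤ ‖D y‖ ^ p := by positivity
          rcases max_choice (max ‖D (y - x)‖ e) ‖D y‖ with h | h
          · rcases max_choice ‖D (y - x)‖ e with h' | h'
            · rw [hm, h, h']; linarith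
            · rw [hm, h, h']; linarith
          · rw [hm, h]; linarith
        calc ‖g (y - x) - g y‖ ^ p ≤ (3 * m) ^ p := Real.rpow_le_rpow (norm_nonneg _) h2 hp0.le
          _ = 3 ^ p * m ^ p := Real.mul_rpow (by norm_num) hm0
          _ ≤ _ := mul_le_mul_of_nonneg_left h3 (by positivity)
      have hsum : ∑ y, μ y * ‖g (y - x) - g y‖ ^ p ≤ (ε * M) ^ p := by
        have h1 : ∑ y, μ y * ‖D (y - x)‖ ^ p ≤ 2 * ∑ y, wp y * ‖D y‖ ^ p := by
          rw [← Equiv.sum_comp (Equiv.addRight x), Finset.mul_sum]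
          refine Finset.sum_le_sum fun z _ => ?_
          simp only [Equiv.coe_addRight, add_sub_cancel_right]
          rw [← mul_assoc]
          refine mul_le_mul_of_nonneg_right ?_ (by positivity)
          have := (hw (-x) hxB z).2
          rw [sub_neg_eq_add] at this
          linarith
        have h2 : ∑ y, μ y * ‖D y‖ ^ p + ∑ y, wp y * ‖D y‖ ^ p ≤ e ^ p := by
          rw [← Finset.sum_add_distrib]
          simp_rw [← add_mul]
          exact hS
        have h3 : 0 ≤ ∑ y, μ y * ‖D y‖ ^ p :=
          Finset.sum_nonneg fun y _ => mul_nonneg (hμ.1 y) (by positivity)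
        calc ∑ y, μ y * ‖g (y - x) - g y‖ ^ p
            ≤ ∑ y, μ y * (3 ^ p * (‖D (y - x)‖ ^ p + e ^ p + ‖D y‖ ^ p)) :=
              Finset.sum_le_sum fun y _ => mul_le_mul_of_nonneg_left (hpt y) (hμ.1 y)
          _ = 3 ^ p * (∑ y, μ y * ‖D (y - x)‖ ^ p + (∑ y, μ y) * e ^ p +
                ∑ y, μ y * ‖D y‖ ^ p) := by
              rw [Finset.sum_mul, ← Finset.sum_add_distrib, ← Finset.sum_add_distrib,
                Finset.mul_sum]
              exact Finset.sum_congr rfl fun y _ => by ring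
          _ ≤ 3 ^ p * (3 * e ^ p) := by
              refine mul_le_mul_of_nonneg_left ?_ (by positivity)
              rw [hμ.2]
              linarith
          _ ≤ 3 ^ p * (3 ^ p * e ^ p) := by
              have : (3 : ℝ) ≤ 3 ^ p := by
                calc (3 : ℝ) = 3 ^ (1 : ℝ) := (Real.rpow_one _).symm
                  _ ≤ 3 ^ p := Real.rpow_le_rpow_of_exponent_le (by norm_num) (by linarith)
              gcongr
          _ = (3 * (3 * e)) ^ p := by
              rw [Real.mul_rpow (by norm_num) (by positivity),
                Real.mul_rpow (by norm_num) hepos.le]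
          _ = (ε * M) ^ p := by
              congr 1; rw [he]; ring
      unfold LpW
      calc (∑ y, μ y * ‖g (y - x) - g y‖ ^ p) ^ (1 / p) ≤ ((ε * M) ^ p) ^ (1 / p) :=
            Real.rpow_le_rpow
              (Finset.sum_nonneg fun y _ => mul_nonneg (hμ.1 y) (by positivity)) hsum
              (by positivity)
        _ = ε * M := by
            rw [one_div, Real.rpow_rpow_inv (by positivity) hp0.ne']


end Paper
end
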